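/- Let A be a hereditary ring and 𝒞 a localizing subcategory of the unbounded derived category D(Mod A). Then the following are equivalent: (1) there exists a coproduct-preserving localization functor L : D(Mod A) → D(Mod A) with Ker L = 𝒞; (2) 𝒞 is generated by perfect complexes, i.e. the smallest localizing subcategory of D(Mod A) containing all perfect complexes belonging to 𝒞 is 𝒞 itself; (3) there exists a localizing subcategory 𝒟 of D(Mod A) that is closed under arbitrary products such that 𝒞 = {X : Hom_{D(Mod A)}(X, D[n]) = 0 for all D ∈ 𝒟 and all n ∈ ℤ}. -/

import Mathlib

open CategoryTheory CategoryTheory.Limits CategoryTheory.Pretriangulated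

universe w u

/-- A ring is (left) hereditary if every submodule of a projective module is projective. -/
def IsHereditaryRing (A : Type u) [Ring A] : Prop :=
  ∀ (M : Type u) [AddCommGroup M] [Module A M], Module.Projective A M →
    ∀ (N : Submodule A M), Module.Projective A N

section frozenDefs
variable {A : Type u} [Ring A] [HasDerivedCategory.{w} (ModuleCat.{u} A)]

/-- A localizing subcategory of the derived category: a strictly full triangulated
subcategory closed under direct summands and arbitrary (set-indexed) coproducts. -/
def IsLocalizingSubcategory (𝒞 : Set (DerivedCategory (ModuleCat.{u} A))) : Prop :=
  (∀ (X : DerivedCategory (ModuleCat.{u} A)), IsZero X → X ∈ 𝒞) ∧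
  (∀ (X Y : DerivedCategory (ModuleCat.{u} A)), X ∈ 𝒞 → (X ≅ Y) → Y ∈ 𝒞) ∧
  (∀ (X : DerivedCategory (ModuleCat.{u} A)) (n : ℤ), X ∈ 𝒞 → (X⟦n⟧) ∈ 𝒞) ∧
  (∀ (T : Triangle (DerivedCategory (ModuleCat.{u} A))),
    (T ∈ distTriang (DerivedCategory (ModuleCat.{u} A))) →
      T.obj₁ ∈ 𝒞 → T.obj₂ ∈ 𝒞 → T.obj₃ ∈ 𝒞) ∧
  (∀ (X Y : DerivedCategory (ModuleCat.{u} A)), (X ⊞ Y) ∈ 𝒞 → X ∈ 𝒞) ∧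
  (∀ (ι : Type u) (g : ι → DerivedCategory (ModuleCat.{u} A)) (c : Cofan g),
    IsColimit c → (∀ i, g i ∈ 𝒞) → c.pt ∈ 𝒞)

/-- A perfect complex: an object of the derived category isomorphic to a bounded complex
of finitely generated projective modules. -/
def IsPerfectComplex (X : DerivedCategory (ModuleCat.{u} A)) : Prop :=
  ∃ (K : CochainComplex (ModuleCat.{u} A) ℤ) (a b : ℤ),
    (∀ n : ℤ, Projective (K.X n) ∧ Module.Finite A (K.X n)) ∧
    (∀ n : ℤ, n < a → IsZero (K.X n)) ∧
    (∀ n : ℤ, b < n → IsZero (K.X n)) ∧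
    Nonempty (DerivedCategory.Q.obj K ≅ X)


end frozenDefs

namespace Tele
section modulePart

variable {A : Type u} [Ring A]

/-- a class of modules closed under isos, products, coproducts, cokernels, extensions -/
structure GoodClass (𝒴 : ModuleCat.{u} A → Prop) : Prop where
  pi : ∀ (ι : Type u) (Y : ι → ModuleCat.{u} A), (∀ i, 𝒴 (Y i)) → 𝒴 (ModuleCat.of A (∀ i, Y i))
  dsum : ∀ (ι : Type u) (Y : ι → ModuleCat.{u} A), (∀ i, 𝒴 (Y i)) →
    𝒴 (ModuleCat.of A (Π₀ i, Y i))
  coker : ∀ (M N : ModuleCat.{u} A) (f : M →ₗ[A] N), 𝒴 M → 𝒴 N →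
    𝒴 (ModuleCat.of A (N ⧸ LinearMap.range f))
  ext : ∀ (M N P : ModuleCat.{u} A) (f : M →ₗ[A] N) (g : N →ₗ[A] P), Function.Injective f →
    Function.Surjective g → (∀ x, g x = 0 ↔ ∃ y, f y = x) → 𝒴 M → 𝒴 P → 𝒴 N

theorem exists_retract_ker (hA : IsHereditaryRing A) {R P : Type u} [AddCommGroup R] [Module A R]
    [AddCommGroup P] [Module A P] (hP : Module.Projective A P) (f : R →ₗ[A] P) :
    ∃ p : R →ₗ[A] LinearMap.ker f, ∀ x : LinearMap.ker f, p x = x := by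
  have := hA P hP (LinearMap.range f)
  obtain ⟨σ, hσ⟩ := Module.projective_lifting_property f.rangeRestrict LinearMap.id
    f.surjective_rangeRestrict
  have hσ' : ∀ y, f.rangeRestrict (σ y) = y := fun y => LinearMap.congr_fun hσ y
  have hσ'' : ∀ y, f (σ y) = y := fun y => congrArg Subtype.val (hσ' y)
  refine ⟨LinearMap.codRestrict _ (LinearMap.id - σ ∘ₗ f.rangeRestrict) ?_, ?_⟩
  · intro x
    simp [hσ'']
  · rintro ⟨x, hx⟩
    have : f.rangeRestrict x = 0 := Subtype.ext (by simpa using hx)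
    ext
    simp [this]

theorem exists_fg_summand (hA : IsHereditaryRing A) {R : Type u} [AddCommGroup R] [Module A R]
    (hR : Module.Projective A R) (F : Submodule A R) (hF : F.FG) :
    ∃ S : Submodule A R, S.FG ∧ F ≤ S ∧ ∃ p : R →ₗ[A] S, ∀ x : S, p x = x := by
  classical
  obtain ⟨s, hs⟩ := hR.out
  obtain ⟨g, hg⟩ := hF
  let t : Finset R := g.biUnion (fun x => (s x).support)
  let T := Finsupp.supported A A (t : Set R)
  let π : (R →₀ A) →ₗ[A] (((t : Set R)ᶜ : Set R) →₀ A) := Finsupp.lsubtypeDomain _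
  have hπ : ∀ x, π x = 0 ↔ x ∈ T := by
    intro x
    rw [Finsupp.mem_supported]
    constructor
    · intro h a ha
      by_contra hat
      have := DFunLike.congr_fun h ⟨a, hat⟩
      simp only [Finset.mem_coe, Finsupp.mem_support_iff] at ha
      exact ha this
    · intro h
      ext ⟨a, ha⟩
      change x a = 0
      by_contra hne
      exact ha (h (by simpa using hne))
  refine ⟨LinearMap.ker (π ∘ₗ s), ?_, ?_, exists_retract_ker hA inferInstance _⟩
  · -- finite generation
    let L := Finsupp.linearCombination A (id : R → R)
    let k : T →ₗ[A] (R →₀ A) := (LinearMap.id - s ∘ₗ L) ∘ₗ T.subtype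
    obtain ⟨p, hp⟩ := exists_retract_ker hA (R := T) (P := R →₀ A) inferInstance k
    have hTfg : Module.Finite A T := by
      have := (Finsupp.supportedEquivFinsupp (M := A) (R := A) (t : Set R)).symm
      exact Module.Finite.equiv this
    have hkfg : Module.Finite A (LinearMap.ker k) :=
      Module.Finite.of_surjective p (fun x => ⟨x, hp x⟩)
    have : LinearMap.ker (π ∘ₗ s) =
        LinearMap.range (L ∘ₗ T.subtype ∘ₗ (LinearMap.ker k).subtype) := by
      ext x
      constructor
      · intro hx
        have hx' : s x ∈ T := (hπ _).1 hx
        refine ⟨⟨⟨s x, hx'⟩, ?_⟩, ?_⟩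
        · have := hs x
          simp [k, L, this]
        · exact hs x
      · rintro ⟨⟨⟨y, hy⟩, hy'⟩, rfl⟩
        have : y - s (L y) = 0 := hy'
        change π (s (L y)) = 0
        rw [← sub_eq_zero.1 this]
        exact (hπ _).2 hy
    rw [this, LinearMap.range_eq_map]
    exact Submodule.FG.map _ (Module.finite_def.1 hkfg)
  · rw [← hg, Submodule.span_le]
    intro x hx
    refine (hπ _).2 ?_
    rw [Finsupp.mem_supported]
    intro a ha
    simp only [t, Finset.coe_biUnion, Set.mem_iUnion]
    exact ⟨x, hx, ha⟩

theorem exists_fg_killing {𝒴 : ModuleCat.{u} A → Prop} (h𝒴 : GoodClass 𝒴)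
    {Q : Type u} [AddCommGroup Q] [Module A Q] (K : Submodule A Q)
    (h : ∀ Y : ModuleCat.{u} A, 𝒴 Y → ∀ f : Q →ₗ[A] Y, (∀ k ∈ K, f k = 0) → f = 0) (q : Q) :
    ∃ U : Submodule A Q, U.FG ∧ U ≤ K ∧
      ∀ Y : ModuleCat.{u} A, 𝒴 Y → ∀ f : Q →ₗ[A] Y, (∀ k ∈ U, f k = 0) → f q = 0 := by
  classical
  by_contra hcon
  push Not at hcon
  let ι := {U : Submodule A Q // U.FG ∧ U ≤ K}
  have hcon' : ∀ U : ι, _ := fun U => hcon U.1 U.2.1 U.2.2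
  choose Y hY f hf hq using hcon'
  let P : ι → ModuleCat.{u} A := fun U₀ => ModuleCat.of A (∀ U : {U : ι // ¬ U₀.1 ≤ U.1}, Y U)
  have hP : ∀ U₀, 𝒴 (P U₀) := fun U₀ => h𝒴.pi _ _ (fun U => hY U)
  let e : ∀ U₀ : ι, P U₀ →ₗ[A] (∀ U, Y U) := fun U₀ =>
    LinearMap.pi (fun U => if hU : ¬ U₀.1 ≤ U.1 then LinearMap.proj (R := A) (ι := {U : ι // ¬ U₀.1 ≤ U.1}) (φ := fun U => Y U) ⟨U, hU⟩ else 0)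
  let Φ : (Π₀ U₀, P U₀) →ₗ[A] (∀ U, Y U) := DFinsupp.lsum ℕ e
  have hZ := h𝒴.coker (ModuleCat.of A (Π₀ U₀, P U₀)) (ModuleCat.of A (∀ U, Y U)) Φ
    (h𝒴.dsum _ _ hP) (h𝒴.pi _ _ hY)
  have hΦ : ∀ z, ∃ U₀ : ι, ∀ U : ι, U₀.1 ≤ U.1 → Φ z U = 0 := by
    intro z
    induction z using DFinsupp.induction with
    | h0 => exact ⟨⟨⊥, Submodule.fg_bot, bot_le⟩, fun U _ => by simp⟩
    | ha i b f h1 h2 ih =>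
      obtain ⟨U₀, hU₀⟩ := ih
      refine ⟨⟨U₀.1 ⊔ i.1, U₀.2.1.sup i.2.1, sup_le U₀.2.2 i.2.2⟩, fun U hU => ?_⟩
      rw [map_add, Pi.add_apply, hU₀ U (le_trans le_sup_left hU), add_zero]
      have hi : i.1 ≤ U.1 := le_trans le_sup_right hU
      simp only [Φ, DFinsupp.lsum_single, e, LinearMap.pi_apply]
      rw [dif_neg (by simpa using hi)]
      rfl
  have key := h _ hZ ((LinearMap.range Φ).mkQ ∘ₗ LinearMap.pi f) (by
    intro k hk
    let U₀ : ι := ⟨Submodule.span A {k}, Submodule.fg_span_singleton k, by simpa using hk⟩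
    simp only [LinearMap.comp_apply, Submodule.mkQ_apply]
    rw [Submodule.Quotient.mk_eq_zero]
    refine ⟨DFinsupp.single U₀ (fun U => f U k), ?_⟩
    ext U
    simp only [Φ, DFinsupp.lsum_single, e, LinearMap.pi_apply]
    by_cases hU : U₀.1 ≤ U.1
    · rw [dif_neg (by simpa using hU)]
      rw [hf U k (hU (Submodule.mem_span_singleton_self k))]
      rfl
    · rw [dif_pos hU]
      rfl)
  have hqq := LinearMap.congr_fun key q
  simp only [LinearMap.comp_apply, Submodule.mkQ_apply, LinearMap.zero_apply] at hqq
  rw [Submodule.Quotient.mk_eq_zero] at hqq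
  obtain ⟨z, hz⟩ := hqq
  obtain ⟨U₀, hU₀⟩ := hΦ z
  have := hU₀ U₀ le_rfl
  rw [hz] at this
  exact hq U₀ this

/-- common kernel -/
def comKer (𝒴 : ModuleCat.{u} A → Prop) {Q : Type u} [AddCommGroup Q] [Module A Q]
    (U : Submodule A Q) : Submodule A Q where
  carrier := {x | ∀ Y : ModuleCat.{u} A, 𝒴 Y → ∀ f : Q →ₗ[A] Y, (∀ k ∈ U, f k = 0) → f x = 0}
  zero_mem' := by intro Y _ f _; simp
  add_mem' := by
    intro a b ha hb Y hY f hf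
    rw [map_add, ha Y hY f hf, hb Y hY f hf, add_zero]
  smul_mem' := by
    intro c a ha Y hY f hf
    rw [map_smul, ha Y hY f hf, smul_zero]

theorem comKer_unique (hA : IsHereditaryRing A) {𝒴 : ModuleCat.{u} A → Prop} (h𝒴 : GoodClass 𝒴)
    {Q : Type u} [AddCommGroup Q] [Module A Q] (U : Submodule A Q) (Y : ModuleCat.{u} A)
    (hY : 𝒴 Y) (g : comKer 𝒴 U →ₗ[A] Y) (hg : ∀ x : comKer 𝒴 U, x.1 ∈ U → g x = 0) : g = 0 := by
  classical
  let ι := {x : Q // x ∉ comKer 𝒴 U}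
  have hex : ∀ x : ι, ∃ Y : ModuleCat.{u} A, 𝒴 Y ∧ ∃ f : Q →ₗ[A] Y, (∀ k ∈ U, f k = 0) ∧
      f x.1 ≠ 0 := by
    rintro ⟨x, hx⟩
    by_contra hc
    push Not at hc
    exact hx hc
  choose Z hZ f hf hfx using hex
  let Y₀ : ModuleCat.{u} A := ModuleCat.of A (∀ x, Z x)
  have hY₀ : 𝒴 Y₀ := h𝒴.pi _ _ hZ
  let φ : Q →ₗ[A] Y₀ := LinearMap.pi f
  have hφ : ∀ x, φ x = 0 ↔ x ∈ comKer 𝒴 U := by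
    intro x
    constructor
    · intro hx
      by_contra hxc
      exact hfx ⟨x, hxc⟩ (congrFun hx ⟨x, hxc⟩)
    · intro hx
      exact hx _ hY₀ φ (fun k hk => by ext i; exact hf i k hk)
  let F := Y₀ →₀ A
  let L : F →ₗ[A] Y₀ := Finsupp.linearCombination A (id : Y₀ → Y₀)
  have hL : Function.Surjective L := fun y => ⟨Finsupp.single y 1, by
    change Finsupp.linearCombination A (id : Y₀ → Y₀) (Finsupp.single y 1) = y
    rw [Finsupp.linearCombination_single, one_smul]; rfl⟩
  let Ψ : (Q × F) →ₗ[A] Y₀ := φ.coprod L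
  let K₀ := LinearMap.ker Ψ
  let pr : K₀ →ₗ[A] F := LinearMap.snd A Q F ∘ₗ K₀.subtype
  obtain ⟨ρ, hρ⟩ := exists_retract_ker hA (R := K₀) (P := F) inferInstance pr
  have hker : ∀ z : LinearMap.ker pr, z.1.1.1 ∈ comKer 𝒴 U := by
    rintro ⟨⟨⟨x, y⟩, h1⟩, h2⟩
    have h2' : y = 0 := h2
    subst h2'
    have h1' : φ x + L 0 = 0 := h1
    rw [map_zero, add_zero] at h1'
    exact (hφ x).1 h1'
  let θ : LinearMap.ker pr →ₗ[A] comKer 𝒴 U :=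
    LinearMap.codRestrict _ (LinearMap.fst A Q F ∘ₗ K₀.subtype ∘ₗ (LinearMap.ker pr).subtype) hker
  let g' : K₀ →ₗ[A] Y := g ∘ₗ θ ∘ₗ ρ
  have hmem : ∀ x : comKer 𝒴 U, ((x : Q), (0 : F)) ∈ K₀ := by
    intro x
    change φ x + L 0 = 0
    rw [map_zero, add_zero]
    exact (hφ x).2 x.2
  have hg' : ∀ x : comKer 𝒴 U, g' ⟨((x : Q), (0 : F)), hmem x⟩ = g x := by
    intro x
    have hk : (⟨((x : Q), (0 : F)), hmem x⟩ : K₀) ∈ LinearMap.ker pr := rfl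
    have := hρ ⟨_, hk⟩
    simp only [g', LinearMap.comp_apply, this]
    rfl
  let κ : K₀ →ₗ[A] ((Q × F) × Y) := K₀.subtype.prod (-g')
  let E : ModuleCat.{u} A := ModuleCat.of A (((Q × F) × Y) ⧸ LinearMap.range κ)
  let i : Y →ₗ[A] E := (LinearMap.range κ).mkQ ∘ₗ LinearMap.inr A (Q × F) Y
  have hκ : LinearMap.range κ ≤ LinearMap.ker (Ψ ∘ₗ LinearMap.fst A (Q × F) Y) := by
    rintro _ ⟨k, rfl⟩
    exact k.2
  let r : E →ₗ[A] Y₀ := (LinearMap.range κ).liftQ (Ψ ∘ₗ LinearMap.fst A (Q × F) Y) hκ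
  have hi : Function.Injective i := by
    rw [injective_iff_map_eq_zero]
    intro y hy
    have hy' : (((0 : Q × F), y) : (Q × F) × Y) ∈ LinearMap.range κ :=
      (Submodule.Quotient.mk_eq_zero _).1 hy
    obtain ⟨k, hk⟩ := hy'
    have h1 : k.1 = 0 := congrArg Prod.fst hk
    have h2 : - g' k = y := congrArg Prod.snd hk
    have h3 : k = 0 := Subtype.ext h1
    rw [← h2, h3, map_zero, neg_zero]
  have hr : Function.Surjective r := by
    intro y
    obtain ⟨a, ha⟩ := hL y
    refine ⟨(LinearMap.range κ).mkQ ((0, a), 0), ?_⟩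
    change φ 0 + L a = y
    rw [map_zero, zero_add, ha]
  have hE : 𝒴 E := by
    refine h𝒴.ext Y E Y₀ i r hi hr ?_ hY hY₀
    intro x
    obtain ⟨⟨z, y⟩, rfl⟩ := Submodule.mkQ_surjective _ x
    constructor
    · intro hz
      have hz' : z ∈ K₀ := hz
      refine ⟨y + g' ⟨z, hz'⟩, ?_⟩
      refine (Submodule.Quotient.eq _).2 ?_
      refine ⟨-⟨z, hz'⟩, ?_⟩
      ext1
      · simp [κ]
      · change -(g' (-⟨z, hz'⟩)) = (y + g' ⟨z, hz'⟩) - y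
        have hneg : g' (-⟨z, hz'⟩) = - g' ⟨z, hz'⟩ := by
          refine eq_neg_of_add_eq_zero_left ?_
          refine (map_add g' _ _).symm.trans ?_
          refine (congrArg g' ?_).trans (map_zero g')
          exact Subtype.ext (neg_add_cancel z)
        refine (congrArg Neg.neg hneg).trans ?_
        rw [neg_neg, add_sub_cancel_left]
    · rintro ⟨y', hy'⟩
      rw [← hy']
      change Ψ 0 = 0
      simp
  let j : Q →ₗ[A] E := (LinearMap.range κ).mkQ ∘ₗ LinearMap.inl A (Q × F) Y ∘ₗ LinearMap.inl A Q F
  have hU : ∀ k ∈ U, k ∈ comKer 𝒴 U := fun k hk Y _ f hf => hf k hk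
  ext x
  have hjx := x.2 E hE j (by
    intro k hk
    refine (Submodule.Quotient.mk_eq_zero _).2 ?_
    refine ⟨⟨(k, 0), hmem ⟨k, hU k hk⟩⟩, ?_⟩
    ext1
    · rfl
    · have := hg' ⟨k, hU k hk⟩
      rw [hg _ hk] at this
      simp [κ, this])
  obtain ⟨k, hk⟩ := (Submodule.Quotient.mk_eq_zero _).1 hjx
  have h1 : k.1 = ((x : Q), (0 : F)) := congrArg Prod.fst hk
  have h2 : - g' k = 0 := congrArg Prod.snd hk
  have h3 : k = ⟨((x : Q), (0 : F)), hmem x⟩ := Subtype.ext h1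
  rw [h3, hg' x, neg_eq_zero] at h2
  rw [h2]; rfl

theorem theoremM (hA : IsHereditaryRing A) {𝒴 : ModuleCat.{u} A → Prop} (h𝒴 : GoodClass 𝒴)
    {Q : Type u} [AddCommGroup Q] [Module A Q] (hQ : Module.Projective A Q) (K : Submodule A Q)
    (h : ∀ Y : ModuleCat.{u} A, 𝒴 Y → ∀ f : Q →ₗ[A] Y, (∀ k ∈ K, f k = 0) → f = 0)
    (h' : ∀ Y : ModuleCat.{u} A, 𝒴 Y → ∀ f : K →ₗ[A] Y, ∃ g : Q →ₗ[A] Y, ∀ k : K, g k = f k)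
    (q : Q) :
    ∃ V U : Submodule A Q, V.FG ∧ U.FG ∧ U ≤ K ∧ q ∈ V ∧ U ≤ V ∧
      (∀ Y : ModuleCat.{u} A, 𝒴 Y → ∀ f : V →ₗ[A] Y, (∀ k : V, k.1 ∈ U → f k = 0) → f = 0) ∧
      (∀ Y : ModuleCat.{u} A, 𝒴 Y → ∀ f : U →ₗ[A] Y, ∃ g : V →ₗ[A] Y,
        ∀ (k : V) (hk : k.1 ∈ U), g k = f ⟨k, hk⟩) := by
  obtain ⟨U₁, hU₁, hU₁K, hU₁q⟩ := exists_fg_killing h𝒴 K h q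
  obtain ⟨S, hS, hUS, p, hp⟩ := exists_fg_summand hA (hA Q hQ K) (U₁.comap K.subtype) (by
    refine Submodule.fg_of_fg_map_injective K.subtype K.injective_subtype ?_
    rwa [Submodule.map_comap_subtype, inf_eq_right.2 hU₁K])
  let U := S.map K.subtype
  have hUK : U ≤ K := Submodule.map_subtype_le K S
  have hU₁U : U₁ ≤ U := fun x hx => ⟨⟨x, hU₁K hx⟩, hUS hx, rfl⟩
  have hUfg : U.FG := hS.map _
  have hqN : q ∈ comKer 𝒴 U := fun Y hY f hf => hU₁q Y hY f (fun k hk => hf k (hU₁U hk))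
  have hUN : U ≤ comKer 𝒴 U := fun k hk Y _ f hf => hf k hk
  obtain ⟨S', hS', hUS', p', hp'⟩ := exists_fg_summand hA (hA Q hQ (comKer 𝒴 U))
    ((U ⊔ Submodule.span A {q}).comap (comKer 𝒴 U).subtype) (by
    refine Submodule.fg_of_fg_map_injective (comKer 𝒴 U).subtype
      (comKer 𝒴 U).injective_subtype ?_
    rw [Submodule.map_comap_subtype, inf_eq_right.2]
    · exact hUfg.sup (Submodule.fg_span_singleton q)
    · exact sup_le hUN (by simpa using hqN))
  let V := S'.map (comKer 𝒴 U).subtype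
  have hVN : V ≤ comKer 𝒴 U := Submodule.map_subtype_le _ _
  have hUV : U ≤ V := fun x hx => ⟨⟨x, hUN hx⟩, hUS' (Submodule.mem_sup_left hx), rfl⟩
  refine ⟨V, U, hS'.map _, hUfg, hUK, ?_, hUV, ?_, ?_⟩
  · exact ⟨⟨q, hqN⟩, hUS' (Submodule.mem_sup_right (Submodule.mem_span_singleton_self q)), rfl⟩
  · intro Y hY f hf
    let τ : S' →ₗ[A] V := LinearMap.codRestrict V ((comKer 𝒴 U).subtype ∘ₗ S'.subtype)
      (fun x => ⟨x.1, x.2, rfl⟩)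
    have hz := comKer_unique hA h𝒴 U Y hY (f ∘ₗ τ ∘ₗ p') (by
      intro x hx
      have hx' : x ∈ S' := hUS' (Submodule.mem_sup_left hx)
      have := hp' ⟨x, hx'⟩
      simp only [LinearMap.comp_apply, this]
      exact hf _ hx)
    ext ⟨k, ⟨x, hx, rfl⟩⟩
    have := LinearMap.congr_fun hz x
    simp only [LinearMap.comp_apply, hp' ⟨x, hx⟩] at this
    exact this
  · intro Y hY f
    let τ : S →ₗ[A] U := LinearMap.codRestrict U (K.subtype ∘ₗ S.subtype)
      (fun x => ⟨x.1, x.2, rfl⟩)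
    obtain ⟨g, hg⟩ := h' Y hY (f ∘ₗ τ ∘ₗ p)
    refine ⟨g ∘ₗ V.subtype, ?_⟩
    intro k hk
    obtain ⟨x, hx, hxk⟩ := id hk
    have := hg x
    simp only [LinearMap.comp_apply, hp ⟨x, hx⟩] at this
    have h1 : (x : Q) = k := hxk
    rw [h1] at this
    change g k = _
    rw [this]
    congr 1
    exact Subtype.ext hxk

end modulePart
end Tele

namespace Tele
section elem
variable {A : Type u} [Ring A]

abbrev CC (A : Type u) [Ring A] := CochainComplex (ModuleCat.{u} A) ℤ

theorem congr_elem {K L : CC A} {f g : K ⟶ L} (n : ℤ) (x : K.X n) (h : f = g) :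
    f.f n x = g.f n x := by rw [h]

theorem homologyπ_surj (K : CC A) (n : ℤ) : Function.Surjective (K.homologyπ n).hom :=
  (ModuleCat.epi_iff_surjective _).1 inferInstance

theorem iCycles_inj (K : CC A) (n : ℤ) : Function.Injective (K.iCycles n).hom :=
  (ModuleCat.mono_iff_injective _).1 inferInstance

theorem exists_cycle (K : CC A) (n : ℤ) (x : K.X n) (hx : K.d n (n+1) x = 0) :
    ∃ z, K.iCycles n z = x := by
  have h := ShortComplex.exact_of_f_is_kernel (ShortComplex.mk (K.iCycles n) (K.d n (n+1)) (by simp))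
    (K.cyclesIsKernel n (n+1) (by simp))
  rw [ShortComplex.moduleCat_exact_iff] at h
  exact h x hx

theorem d_iCycles (K : CC A) (n m : ℤ) (z : K.cycles n) : K.d n m (K.iCycles n z) = 0 := by
  have := K.iCycles_d n m
  exact ConcreteCategory.congr_hom this z

theorem homologyπ_eq_zero_iff (K : CC A) (n : ℤ) (z : K.cycles n) :
    K.homologyπ n z = 0 ↔ ∃ y, K.d (n-1) n y = K.iCycles n z := by
  have h := ShortComplex.exact_of_g_is_cokernel
    (ShortComplex.mk (K.toCycles (n-1) n) (K.homologyπ n) (by simp))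
    (K.homologyIsCokernel (n-1) n (by simp))
  rw [ShortComplex.moduleCat_exact_iff] at h
  have h2 := K.toCycles_i (n-1) n
  constructor
  · intro hz
    obtain ⟨y, hy⟩ := h z hz
    refine ⟨y, ?_⟩
    rw [← h2, ← hy]; rfl
  · rintro ⟨y, hy⟩
    have : z = K.toCycles (n-1) n y := by
      apply iCycles_inj K n
      rw [← h2] at hy
      exact hy.symm
    rw [this]
    exact ConcreteCategory.congr_hom (K.toCycles_comp_homologyπ (n-1) n) y

theorem quasiIso_iff_elem {K L : CC A} (f : K ⟶ L) :
    QuasiIso f ↔ (∀ n : ℤ,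
      (∀ x : K.X n, K.d n (n+1) x = 0 → (∃ y, L.d (n-1) n y = f.f n x) →
        ∃ y, K.d (n-1) n y = x) ∧
      (∀ x : L.X n, L.d n (n+1) x = 0 → ∃ x' y, K.d n (n+1) x' = 0 ∧
        x = f.f n x' + L.d (n-1) n y)) := by
  rw [quasiIso_iff]
  refine forall_congr' fun n => ?_
  rw [quasiIsoAt_iff_isIso_homologyMap, ConcreteCategory.isIso_iff_bijective]
  have hnat : ∀ z, HomologicalComplex.homologyMap f n (K.homologyπ n z) =
      L.homologyπ n (HomologicalComplex.cyclesMap f n z) := fun z =>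
    ConcreteCategory.congr_hom (HomologicalComplex.homologyπ_naturality f n) z
  have hcyc : ∀ z, L.iCycles n (HomologicalComplex.cyclesMap f n z) = f.f n (K.iCycles n z) :=
    fun z => ConcreteCategory.congr_hom (HomologicalComplex.cyclesMap_i f n) z
  refine and_congr ?_ ?_
  · rw [injective_iff_map_eq_zero]
    constructor
    · intro h x hx hy
      obtain ⟨z, rfl⟩ := exists_cycle K n x hx
      rw [← homologyπ_eq_zero_iff]
      apply h
      rw [hnat, homologyπ_eq_zero_iff, hcyc]
      exact hy
    · intro h x hx
      obtain ⟨z, rfl⟩ := homologyπ_surj K n x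
      have hx' : HomologicalComplex.homologyMap f n (K.homologyπ n z) = 0 := hx
      rw [hnat, homologyπ_eq_zero_iff, hcyc] at hx'
      exact (homologyπ_eq_zero_iff _ _ _).2 (h _ (d_iCycles K n _ z) hx')
  · constructor
    · intro h x hx
      obtain ⟨z, rfl⟩ := exists_cycle L n x hx
      obtain ⟨y, hy⟩ := h (L.homologyπ n z)
      obtain ⟨z', rfl⟩ := homologyπ_surj K n y
      have hy' : HomologicalComplex.homologyMap f n (K.homologyπ n z') = _ := hy
      rw [hnat] at hy'
      have h0 : L.homologyπ n (z - HomologicalComplex.cyclesMap f n z') = 0 := by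
        rw [map_sub, hy', sub_self]
      obtain ⟨t, ht⟩ := (homologyπ_eq_zero_iff _ _ _).1 h0
      refine ⟨K.iCycles n z', t, d_iCycles K n _ z', ?_⟩
      rw [ht, map_sub, hcyc]; abel
    · intro h y
      obtain ⟨z, rfl⟩ := homologyπ_surj L n y
      obtain ⟨x', t, hx', he⟩ := h (L.iCycles n z) (d_iCycles L n _ z)
      obtain ⟨z', rfl⟩ := exists_cycle K n x' hx'
      refine ⟨K.homologyπ n z', ?_⟩
      rw [hnat]
      have : L.homologyπ n (z - HomologicalComplex.cyclesMap f n z') = 0 := by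
        rw [homologyπ_eq_zero_iff]
        refine ⟨t, ?_⟩
        rw [map_sub, hcyc, he]; abel
      rw [map_sub, sub_eq_zero] at this
      exact this.symm

end elem

section conc
variable {A : Type u} [Ring A] {ι : Type u}
open Classical in
/-- concrete direct sum of complexes -/
noncomputable def dsumC (K : ι → CC A) : CC A where
  X n := ModuleCat.of A (Π₀ i, (K i).X n)
  d n m := ModuleCat.ofHom (DFinsupp.mapRange.linearMap fun i => ((K i).d n m).hom)
  shape n m h := by
    refine ModuleCat.hom_ext (LinearMap.ext fun x => ?_)
    refine DFinsupp.ext (β := fun i => (K i).X m) fun i => ?_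
    have := (K i).shape n m h
    exact ConcreteCategory.congr_hom this
      (DFunLike.coe (F := Π₀ i, (K i).X n) x i)
  d_comp_d' n m k _ _ := by
    refine ModuleCat.hom_ext (LinearMap.ext fun x => ?_)
    refine DFinsupp.ext (β := fun i => (K i).X k) fun i => ?_
    have := (K i).d_comp_d n m k
    exact ConcreteCategory.congr_hom this (DFunLike.coe (F := Π₀ i, (K i).X n) x i)

/-- concrete product of complexes -/
def piC (K : ι → CC A) : CC A where
  X n := ModuleCat.of A (∀ i, (K i).X n)
  d n m := ModuleCat.ofHom (LinearMap.pi fun i => ((K i).d n m).hom ∘ₗ LinearMap.proj i)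
  shape n m h := by
    ext x i
    have := (K i).shape n m h
    exact ConcreteCategory.congr_hom this (x i)
  d_comp_d' n m k _ _ := by
    ext x i
    have := (K i).d_comp_d n m k
    exact ConcreteCategory.congr_hom this (x i)

theorem dsumC_d (K : ι → CC A) (n m : ℤ) (x : (dsumC K).X n) (i : ι) :
    DFunLike.coe (F := Π₀ i, (K i).X m) ((dsumC K).d n m x) i = (K i).d n m (DFunLike.coe (F := Π₀ i, (K i).X n) x i) := rfl

theorem piC_d (K : ι → CC A) (n m : ℤ) (x : (piC K).X n) (i : ι) :
    (show ∀ i, (K i).X m from ((piC K).d n m x)) i =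
      (K i).d n m ((show ∀ i, (K i).X n from x) i) := rfl

open Classical in
noncomputable def dsumι (K : ι → CC A) (i : ι) : K i ⟶ dsumC K where
  f n := ModuleCat.ofHom (DFinsupp.lsingle (M := fun i => (K i).X n) i)
  comm' n m _ := by
    ext x
    refine DFinsupp.ext fun j => ?_
    change (K j).d n m ((DFinsupp.single i x : Π₀ i, (K i).X n) j) =
      (DFinsupp.single i ((K i).d n m x) : Π₀ i, (K i).X m) j
    by_cases h : i = j
    · subst h; simp
    · rw [DFinsupp.single_eq_of_ne (Ne.symm h), DFinsupp.single_eq_of_ne (Ne.symm h), map_zero]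

open Classical in
noncomputable def dsumDesc (K : ι → CC A) (L : CC A) (f : ∀ i, K i ⟶ L) : dsumC K ⟶ L where
  f n := ModuleCat.ofHom (DFinsupp.lsum ℕ (M := fun i => (K i).X n) fun i => ((f i).f n).hom)
  comm' n m _ := by
    refine ModuleCat.hom_ext (DFinsupp.lhom_ext (M := fun i => (K i).X n) fun i b => ?_)
    have h1 : (dsumC K).d n m (DFinsupp.single i b : Π₀ i, (K i).X n) =
        (DFinsupp.single i ((K i).d n m b) : Π₀ i, (K i).X m) :=
      ConcreteCategory.congr_hom ((dsumι K i).comm n m) b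
    have h2 : L.d n m ((f i).f n b) = (f i).f m ((K i).d n m b) :=
      ConcreteCategory.congr_hom ((f i).comm n m) b
    change L.d n m (DFinsupp.lsum ℕ (M := fun i => (K i).X n) (fun i => ((f i).f n).hom)
        (DFinsupp.single i b)) =
      DFinsupp.lsum ℕ (M := fun i => (K i).X m) (fun i => ((f i).f m).hom)
        ((dsumC K).d n m (DFinsupp.single i b : Π₀ i, (K i).X n))
    refine Eq.trans ?_ (congrArg _ h1).symm
    rw [DFinsupp.lsum_single, DFinsupp.lsum_single]
    exact h2

theorem dsumι_desc (K : ι → CC A) (L : CC A) (f : ∀ i, K i ⟶ L) (i : ι) :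
    dsumι K i ≫ dsumDesc K L f = f i := by
  classical
  ext n x
  change DFinsupp.lsum ℕ (M := fun i => (K i).X n) (fun i => ((f i).f n).hom)
    (DFinsupp.single i x) = _
  rw [DFinsupp.lsum_single]

theorem dsum_hom_ext (K : ι → CC A) (L : CC A) (f g : dsumC K ⟶ L)
    (h : ∀ i, dsumι K i ≫ f = dsumι K i ≫ g) : f = g := by
  classical
  refine HomologicalComplex.hom_ext _ _ fun n => ?_
  refine ModuleCat.hom_ext (DFinsupp.lhom_ext (M := fun i => (K i).X n) fun i b => ?_)
  exact congr_elem n b (h i)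

def piπ (K : ι → CC A) (i : ι) : piC K ⟶ K i where
  f n := ModuleCat.ofHom (LinearMap.proj (φ := fun i => (K i).X n) i)
  comm' n m _ := rfl

def piLift (K : ι → CC A) (L : CC A) (f : ∀ i, L ⟶ K i) : L ⟶ piC K where
  f n := ModuleCat.ofHom (LinearMap.pi (φ := fun i => (K i).X n) fun i => ((f i).f n).hom)
  comm' n m _ := by
    ext x
    refine funext fun i => ?_
    exact ConcreteCategory.congr_hom ((f i).comm n m) x

theorem piLift_π (K : ι → CC A) (L : CC A) (f : ∀ i, L ⟶ K i) (i : ι) :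
    piLift K L f ≫ piπ K i = f i := rfl

theorem pi_hom_ext (K : ι → CC A) (L : CC A) (f g : L ⟶ piC K)
    (h : ∀ i, f ≫ piπ K i = g ≫ piπ K i) : f = g := by
  ext n x
  refine funext fun i => ?_
  exact congr_elem n x (h i)

noncomputable def dsumMap {K L : ι → CC A} (f : ∀ i, K i ⟶ L i) : dsumC K ⟶ dsumC L :=
  dsumDesc K _ (fun i => f i ≫ dsumι L i)

theorem dsumMap_apply {K L : ι → CC A} (f : ∀ i, K i ⟶ L i) (n : ℤ) (x : Π₀ i, (K i).X n) (i : ι) :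
    DFunLike.coe (F := Π₀ i, (L i).X n) ((dsumMap f).f n x) i = (f i).f n (x i) := by
  classical
  induction x using DFinsupp.induction with
  | h0 =>
    erw [map_zero ((dsumMap f).f n).hom]
    exact (map_zero ((f i).f n).hom).symm
  | ha j b t _ _ ih =>
    have e1 : DFunLike.coe (F := Π₀ i, (L i).X n) ((dsumMap f).f n (DFinsupp.single j b + t : Π₀ i, (K i).X n)) i =
      DFunLike.coe (F := Π₀ i, (L i).X n) ((dsumMap f).f n (DFinsupp.single j b : Π₀ i, (K i).X n)) i + DFunLike.coe (F := Π₀ i, (L i).X n) ((dsumMap f).f n t) i :=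
      congrArg (fun z => DFunLike.coe (F := Π₀ i, (L i).X n) z i) (map_add ((dsumMap f).f n).hom _ _)
    rw [e1, ih, DFinsupp.add_apply, map_add]
    congr 1
    have := congr_elem n b (dsumι_desc K _ (fun i => f i ≫ dsumι L i) j)
    have h2 : (dsumMap f).f n (DFinsupp.single j b : Π₀ i, (K i).X n) =
      (DFinsupp.single j ((f j).f n b) : Π₀ i, (L i).X n) := this
    rw [h2]
    by_cases h : j = i
    · subst h; simp
    · rw [DFinsupp.single_eq_of_ne (Ne.symm h), DFinsupp.single_eq_of_ne (Ne.symm h), map_zero]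

theorem quasiIso_dsumMap {K L : ι → CC A} (f : ∀ i, K i ⟶ L i) (h : ∀ i, QuasiIso (f i)) :
    QuasiIso (dsumMap f) := by
  classical
  rw [quasiIso_iff_elem]
  simp only [quasiIso_iff_elem] at h
  intro n
  -- build elements of a direct sum with prescribed support
  have mk : ∀ (M : ι → ModuleCat.{u} A) (s : Finset ι) (g : ∀ i, M i), (∀ i, i ∉ s → g i = 0) →
      ∃ z : Π₀ i, M i, ∀ i, z i = g i := by
    intro M s g hg
    refine ⟨DFinsupp.mk s (fun i => g i), fun i => ?_⟩
    by_cases hi : i ∈ s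
    · simp [DFinsupp.mk_apply, hi]
    · simp [DFinsupp.mk_apply, hi, hg i hi]
  constructor
  · change ∀ x : Π₀ i, (K i).X n, _
    rintro x hx ⟨y, hy⟩
    have hex : ∀ i, ∃ z, (x i = 0 → z = 0) ∧ (K i).d (n-1) n z = x i := by
      intro i
      by_cases h0 : x i = 0
      · exact ⟨0, fun _ => rfl, by rw [h0, map_zero]⟩
      · have h1 : (K i).d n (n+1) (x i) = 0 := congrArg (fun z => DFunLike.coe (F := Π₀ i, (K i).X (n+1)) z i) hx
        have h2 := congrArg (fun z => DFunLike.coe (F := Π₀ i, (L i).X n) z i) hy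
        obtain ⟨z, hz⟩ := ((h i n).1 (x i) h1 ⟨_, h2.trans (dsumMap_apply f n x i)⟩)
        exact ⟨z, fun h => (h0 h).elim, hz⟩
    choose g hg0 hg using hex
    obtain ⟨z, hz⟩ := mk (fun i => (K i).X (n-1)) x.support g (fun i hi => hg0 i (by simpa using hi))
    refine ⟨z, DFinsupp.ext fun i => ?_⟩
    refine (dsumC_d K (n-1) n z i).trans ?_
    rw [hz, hg]
  · change ∀ x : Π₀ i, (L i).X n, _
    intro x hx
    have hex : ∀ i, ∃ a b, (x i = 0 → a = 0 ∧ b = 0) ∧ (K i).d n (n+1) a = 0 ∧ x i = (f i).f n a + (L i).d (n-1) n b := by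
      intro i
      by_cases h0 : x i = 0
      · exact ⟨0, 0, fun _ => ⟨rfl, rfl⟩, by rw [map_zero], by rw [h0, map_zero, map_zero, add_zero]⟩
      · have h1 : (L i).d n (n+1) (x i) = 0 := congrArg (fun z => DFunLike.coe (F := Π₀ i, (L i).X (n+1)) z i) hx
        obtain ⟨a, b, h2, h3⟩ := (h i n).2 (x i) h1
        exact ⟨a, b, fun h => (h0 h).elim, h2, h3⟩
    choose a b h0 ha hb using hex
    obtain ⟨z, hz⟩ := mk (fun i => (K i).X n) x.support a (fun i hi => (h0 i (by simpa using hi)).1)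
    obtain ⟨t, ht⟩ := mk (fun i => (L i).X (n-1)) x.support b (fun i hi => (h0 i (by simpa using hi)).2)
    refine ⟨z, t, DFinsupp.ext fun i => ?_, DFinsupp.ext fun i => ?_⟩
    · refine (dsumC_d K n (n+1) z i).trans ?_
      rw [hz, ha]; rfl
    · rw [hb i]
      refine Eq.trans ?_ (congrArg₂ (· + ·) (dsumMap_apply f n z i) (dsumC_d L (n-1) n t i)).symm
      rw [hz, ht]

def piMap {K L : ι → CC A} (f : ∀ i, K i ⟶ L i) : piC K ⟶ piC L :=
  piLift _ _ (fun i => piπ K i ≫ f i)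

theorem quasiIso_piMap {K L : ι → CC A} (f : ∀ i, K i ⟶ L i) (h : ∀ i, QuasiIso (f i)) :
    QuasiIso (piMap f) := by
  rw [quasiIso_iff_elem]
  simp only [quasiIso_iff_elem] at h
  intro n
  constructor
  · change ∀ x : ∀ i, (K i).X n, _
    rintro x hx ⟨y, hy⟩
    have hex : ∀ i, ∃ z, (K i).d (n-1) n z = x i := fun i =>
      (h i n).1 (x i) (congrFun hx i) ⟨(show ∀ i, (L i).X (n-1) from y) i, congrFun hy i⟩
    choose g hg using hex
    exact ⟨g, funext hg⟩
  · change ∀ x : ∀ i, (L i).X n, _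
    intro x hx
    choose a b ha hb using fun i => (h i n).2 (x i) (congrFun hx i)
    exact ⟨a, b, funext ha, funext hb⟩

end conc
end Tele

namespace Tele
section coprodD
variable {A : Type u} [Ring A]

theorem exists_of_null {X Y : CC A} (f : X ⟶ Y)
    (h : (HomotopyCategory.quotient (ModuleCat.{u} A) (ComplexShape.up ℤ)).map f = 0) :
    ∃ b : CochainComplex.mappingCone (𝟙 X) ⟶ Y, CochainComplex.mappingCone.inr (𝟙 X) ≫ b = f := by
  have ho : Homotopy f 0 := HomotopyCategory.homotopyOfEq f 0 (by rw [h, Functor.map_zero])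
  refine ⟨CochainComplex.mappingCone.desc (𝟙 X) (CochainComplex.HomComplex.Cochain.ofHomotopy ho) f ?_, ?_⟩
  · simp
  · simp

variable [HasDerivedCategory.{w} (ModuleCat.{u} A)]

abbrev DD (A : Type u) [Ring A] [HasDerivedCategory.{w} (ModuleCat.{u} A)] :=
  DerivedCategory (ModuleCat.{u} A)

theorem isZero_cone_id (X : CC A) :
    IsZero ((DerivedCategory.Q (C := ModuleCat.{u} A)).obj (CochainComplex.mappingCone (𝟙 X))) := by
  have h := DerivedCategory.mappingCone_triangle_distinguished (𝟙 X)
  refine (Triangle.isZero₃_iff_isIso₁ _ h).2 ?_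
  change IsIso ((DerivedCategory.Q (C := ModuleCat.{u} A)).map (𝟙 X))
  infer_instance

theorem fac_pre {X Y : CC A} (h : X ⟶ Y) (h0 : (DerivedCategory.Q (C := ModuleCat.{u} A)).map h = 0) :
    ∃ (X' : CC A) (s : X' ⟶ X) (b : CochainComplex.mappingCone (𝟙 X') ⟶ Y),
      QuasiIso s ∧ s ≫ h = CochainComplex.mappingCone.inr (𝟙 X') ≫ b := by
  have h1 : DerivedCategory.Qh.map ((HomotopyCategory.quotient (ModuleCat.{u} A) (ComplexShape.up ℤ)).map h) =
    DerivedCategory.Qh.map ((HomotopyCategory.quotient (ModuleCat.{u} A) (ComplexShape.up ℤ)).map 0) := by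
    rw [Functor.map_zero, Functor.map_zero]
    exact h0
  rw [MorphismProperty.map_eq_iff_precomp _ (HomotopyCategory.quasiIso (ModuleCat.{u} A) (ComplexShape.up ℤ))] at h1
  obtain ⟨X', s, hs, he⟩ := h1
  obtain ⟨X', rfl⟩ := HomotopyCategory.quotient_obj_surjective X'
  obtain ⟨s, rfl⟩ := (HomotopyCategory.quotient _ _).map_surjective s
  rw [← Functor.map_comp, Functor.map_zero, comp_zero] at he
  obtain ⟨b, hb⟩ := exists_of_null _ he
  refine ⟨X', s, b, ?_, hb.symm⟩
  rwa [HomotopyCategory.quotient_map_mem_quasiIso_iff] at hs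

theorem fac_post {X Y : CC A} (h : X ⟶ Y) (h0 : (DerivedCategory.Q (C := ModuleCat.{u} A)).map h = 0) :
    ∃ (Y' : CC A) (s : Y ⟶ Y') (b : CochainComplex.mappingCone (𝟙 X) ⟶ Y'),
      QuasiIso s ∧ h ≫ s = CochainComplex.mappingCone.inr (𝟙 X) ≫ b := by
  have h1 : DerivedCategory.Qh.map ((HomotopyCategory.quotient (ModuleCat.{u} A) (ComplexShape.up ℤ)).map h) =
    DerivedCategory.Qh.map ((HomotopyCategory.quotient (ModuleCat.{u} A) (ComplexShape.up ℤ)).map 0) := by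
    rw [Functor.map_zero, Functor.map_zero]
    exact h0
  rw [MorphismProperty.map_eq_iff_postcomp _ (HomotopyCategory.quasiIso (ModuleCat.{u} A) (ComplexShape.up ℤ))] at h1
  obtain ⟨X', s, hs, he⟩ := h1
  obtain ⟨X', rfl⟩ := HomotopyCategory.quotient_obj_surjective X'
  obtain ⟨s, rfl⟩ := (HomotopyCategory.quotient _ _).map_surjective s
  rw [← Functor.map_comp, Functor.map_zero, zero_comp] at he
  obtain ⟨b, hb⟩ := exists_of_null _ he
  refine ⟨X', s, b, ?_, hb.symm⟩
  rwa [HomotopyCategory.quotient_map_mem_quasiIso_iff] at hs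

theorem isIso_Q_of_quasiIso {X Y : CC A} (s : X ⟶ Y) (h : QuasiIso s) :
    IsIso ((DerivedCategory.Q (C := ModuleCat.{u} A)).map s) :=
  (DerivedCategory.isIso_Q_map_iff_quasiIso _ _).2 h

theorem quasiIso_of_isIso_Q {X Y : CC A} (s : X ⟶ Y) (h : IsIso
    ((DerivedCategory.Q (C := ModuleCat.{u} A)).map s)) : QuasiIso s :=
  (DerivedCategory.isIso_Q_map_iff_quasiIso _ _).1 h

variable {ι : Type u}
open DerivedCategory in
theorem dsum_exists (K : ι → CC A) (Y : DD A) (f : ∀ i, Q.obj (K i) ⟶ Y) :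
    ∃ g : Q.obj (dsumC K) ⟶ Y, ∀ i, Q.map (dsumι K i) ≫ g = f i := by
  obtain ⟨Y, ⟨e⟩⟩ : ∃ Y' : CC A, Nonempty (Q.obj Y' ≅ Y) := ⟨_, ⟨Q.objObjPreimageIso Y⟩⟩
  choose X s hs g hg using fun i => right_fac (f i ≫ e.inv)
  have := isIso_Q_of_quasiIso _ (quasiIso_dsumMap s (fun i => quasiIso_of_isIso_Q _ (hs i)))
  refine ⟨inv (Q.map (dsumMap s)) ≫ Q.map (dsumDesc X Y g) ≫ e.hom, fun i => ?_⟩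
  have := hs i
  rw [← cancel_epi (Q.map (s i)), ← Functor.map_comp_assoc]
  have h1 : s i ≫ dsumι K i = dsumι X i ≫ dsumMap s :=
    (dsumι_desc X _ (fun i => s i ≫ dsumι K i) i).symm
  rw [h1, Functor.map_comp_assoc, IsIso.hom_inv_id_assoc, ← Functor.map_comp_assoc, dsumι_desc]
  have h2 := hg i
  rw [← cancel_mono e.inv, Category.assoc, Category.assoc, e.hom_inv_id, Category.comp_id, h2,
    IsIso.hom_inv_id_assoc]

open DerivedCategory in
theorem dsum_unique (K : ι → CC A) (Y : DD A) (f : Q.obj (dsumC K) ⟶ Y)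
    (h : ∀ i, Q.map (dsumι K i) ≫ f = 0) : f = 0 := by
  obtain ⟨Y, ⟨e⟩⟩ : ∃ Y' : CC A, Nonempty (Q.obj Y' ≅ Y) := ⟨_, ⟨Q.objObjPreimageIso Y⟩⟩
  obtain ⟨Y', g, t, ht, hg⟩ := left_fac (f ≫ e.inv)
  have h1 : ∀ i, Q.map (dsumι K i ≫ g) = 0 := by
    intro i
    rw [Functor.map_comp, ← cancel_mono (inv (Q.map t)), Category.assoc, ← hg, reassoc_of% (h i)]
    simp
  choose X s b hs hb using fun i => fac_pre _ (h1 i)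
  let C := fun i => CochainComplex.mappingCone (𝟙 (X i))
  have hz : IsZero (Q.obj (dsumC C)) := by
    have hq : QuasiIso (dsumMap (fun i => (0 : C i ⟶ C i))) := by
      refine quasiIso_dsumMap _ (fun i => quasiIso_of_isIso_Q _ ?_)
      have hi := isZero_cone_id (X i)
      exact ⟨0, hi.eq_of_src _ _, hi.eq_of_src _ _⟩
    have h0 : dsumMap (fun i => (0 : C i ⟶ C i)) = 0 := by
      refine dsum_hom_ext _ _ _ _ fun i => ?_
      refine (dsumι_desc _ _ _ i).trans ?_
      simp
    have := isIso_Q_of_quasiIso _ hq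
    rw [h0, Functor.map_zero] at this
    refine (IsZero.iff_id_eq_zero _).2 ?_
    rw [← IsIso.hom_inv_id (0 : Q.obj (dsumC C) ⟶ Q.obj (dsumC C)), zero_comp]
  have hi := isIso_Q_of_quasiIso _ (quasiIso_dsumMap s hs)
  have h2 : dsumMap s ≫ g =
      dsumMap (fun i => CochainComplex.mappingCone.inr (𝟙 (X i))) ≫ dsumDesc C Y' b := by
    refine dsum_hom_ext _ _ _ _ fun i => ?_
    rw [← Category.assoc, ← Category.assoc]
    have e1 : dsumι X i ≫ dsumMap s = _ := dsumι_desc _ _ _ i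
    have e2 : dsumι X i ≫ dsumMap (fun i => CochainComplex.mappingCone.inr (𝟙 (X i))) = _ :=
      dsumι_desc _ _ _ i
    rw [e1, e2, Category.assoc, Category.assoc, dsumι_desc, hb]
  have h3 : Q.map g = 0 := by
    rw [← cancel_epi (Q.map (dsumMap s)), ← Functor.map_comp, h2, Functor.map_comp, comp_zero,
      hz.eq_of_tgt (Q.map (dsumMap _)) 0, zero_comp]
  rw [← cancel_mono e.inv, hg, h3, zero_comp, zero_comp]

open DerivedCategory in
theorem pi_exists (K : ι → CC A) (Y : DD A) (f : ∀ i, Y ⟶ Q.obj (K i)) :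
    ∃ g : Y ⟶ Q.obj (piC K), ∀ i, g ≫ Q.map (piπ K i) = f i := by
  obtain ⟨Y, ⟨e⟩⟩ : ∃ Y' : CC A, Nonempty (Q.obj Y' ≅ Y) := ⟨_, ⟨Q.objObjPreimageIso Y⟩⟩
  choose X g s hs hg using fun i => left_fac (e.hom ≫ f i)
  have := isIso_Q_of_quasiIso _ (quasiIso_piMap s (fun i => quasiIso_of_isIso_Q _ (hs i)))
  refine ⟨e.inv ≫ Q.map (piLift X Y g) ≫ inv (Q.map (piMap s)), fun i => ?_⟩
  have := hs i
  rw [← cancel_mono (Q.map (s i)), Category.assoc, Category.assoc, Category.assoc, 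
    ← Functor.map_comp]
  have h1 : piπ K i ≫ s i = piMap s ≫ piπ X i := rfl
  rw [h1, Functor.map_comp, IsIso.inv_hom_id_assoc, ← Functor.map_comp, piLift_π]
  have h2 := hg i
  rw [← cancel_epi e.hom, e.hom_inv_id_assoc, ← Category.assoc, h2, Category.assoc,
    IsIso.inv_hom_id, Category.comp_id]

open DerivedCategory in
theorem pi_unique (K : ι → CC A) (Y : DD A) (f : Y ⟶ Q.obj (piC K))
    (h : ∀ i, f ≫ Q.map (piπ K i) = 0) : f = 0 := by
  obtain ⟨Y, ⟨e⟩⟩ : ∃ Y' : CC A, Nonempty (Q.obj Y' ≅ Y) := ⟨_, ⟨Q.objObjPreimageIso Y⟩⟩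
  obtain ⟨Y', t, ht, g, hg⟩ := right_fac (e.hom ≫ f)
  have h1 : ∀ i, Q.map (g ≫ piπ K i) = 0 := by
    intro i
    rw [Functor.map_comp, ← cancel_epi (inv (Q.map t)), ← Category.assoc, ← hg, Category.assoc, h i]
    simp
  choose X s b hs hb using fun i => fac_post _ (h1 i)
  have hi := isIso_Q_of_quasiIso _ (quasiIso_piMap s hs)
  have h2 : g ≫ piMap s = CochainComplex.mappingCone.inr (𝟙 Y') ≫ piLift _ _ b := by
    refine pi_hom_ext _ _ _ _ fun i => ?_
    exact hb i
  have h3 : Q.map g = 0 := by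
    rw [← cancel_mono (Q.map (piMap s)), ← Functor.map_comp, h2, Functor.map_comp, zero_comp,
      (isZero_cone_id Y').eq_of_src (Q.map (piLift _ _ b)) 0, comp_zero]
  rw [← cancel_epi e.hom, hg, h3, comp_zero, comp_zero]

open DerivedCategory in
/-- the coproduct cofan in complexes -/
noncomputable def dsumIsColimit (K : ι → CC A) : IsColimit (Cofan.mk (dsumC K) (dsumι K)) :=
  Cofan.IsColimit.mk _ (fun s => dsumDesc _ _ s.inj) (fun s i => dsumι_desc _ _ _ i)
    (fun s m hm => dsum_hom_ext _ _ _ _ (fun i => (hm i).trans (dsumι_desc _ _ _ i).symm))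

noncomputable def piIsLimit (K : ι → CC A) : IsLimit (Fan.mk (piC K) (piπ K)) :=
  Fan.IsLimit.mk _ (fun s => piLift _ _ s.proj) (fun s i => rfl)
    (fun s m hm => pi_hom_ext _ _ _ _ (fun i => hm i))

open DerivedCategory in
noncomputable def QdsumIsColimit (K : ι → CC A) :
    IsColimit (Cofan.mk (Q.obj (dsumC K)) (fun i => Q.map (dsumι K i))) :=
  Cofan.IsColimit.mk _ (fun s => (dsum_exists K _ s.inj).choose)
    (fun s i => (dsum_exists K _ s.inj).choose_spec i)
    (fun s m hm => by
      rw [← sub_eq_zero]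
      refine dsum_unique _ _ _ (fun i => ?_)
      rw [Preadditive.comp_sub, sub_eq_zero]
      exact (hm i).trans ((dsum_exists K _ s.inj).choose_spec i).symm)

open DerivedCategory in
noncomputable def QpiIsLimit (K : ι → CC A) :
    IsLimit (Fan.mk (Q.obj (piC K)) (fun i => Q.map (piπ K i))) :=
  Fan.IsLimit.mk _ (fun s => (pi_exists K _ s.proj).choose)
    (fun s i => (pi_exists K _ s.proj).choose_spec i)
    (fun s m hm => by
      rw [← sub_eq_zero]
      refine pi_unique _ _ _ (fun i => ?_)
      rw [Preadditive.sub_comp, sub_eq_zero]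
      exact (hm i).trans ((pi_exists K _ s.proj).choose_spec i).symm)

instance Q_preserves : PreservesColimitsOfShape (Discrete ι)
    (DerivedCategory.Q (C := ModuleCat.{u} A)) := by
  have : ∀ f : ι → CC A, PreservesColimit (Discrete.functor f)
      (DerivedCategory.Q (C := ModuleCat.{u} A)) := fun f =>
    preservesColimit_of_preserves_colimit_cocone (dsumIsColimit f)
      ((isColimitMapCoconeCofanMkEquiv _ _ _).symm (QdsumIsColimit f))
  exact preservesColimitsOfShape_of_discrete _

instance Q_preservesLim : PreservesLimitsOfShape (Discrete ι)
    (DerivedCategory.Q (C := ModuleCat.{u} A)) := by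
  have : ∀ f : ι → CC A, PreservesLimit (Discrete.functor f)
      (DerivedCategory.Q (C := ModuleCat.{u} A)) := fun f =>
    preservesLimit_of_preserves_limit_cone (piIsLimit f)
      ((isLimitMapConeFanMkEquiv _ _ _).symm (QpiIsLimit f))
  exact preservesLimitsOfShape_of_discrete _

instance : HasCoproductsOfShape ι (DD A) := by
  have : ∀ f : ι → DD A, HasCoproduct f := by
    intro f
    let K : ι → CC A := fun i => DerivedCategory.Q.objPreimage (f i)
    let e : ∀ i, DerivedCategory.Q.obj (K i) ≅ f i := fun i => DerivedCategory.Q.objObjPreimageIso _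
    have : HasColimit (Discrete.functor fun i => DerivedCategory.Q.obj (K i)) := ⟨⟨_, QdsumIsColimit K⟩⟩
    exact hasColimit_of_iso (Discrete.natIso fun i => (e i.as).symm : Discrete.functor f ≅ Discrete.functor fun i => DerivedCategory.Q.obj (K i))
  have h2 : ∀ F : Discrete ι ⥤ DD A, HasColimit F := fun F =>
    hasColimit_of_iso (Discrete.natIsoFunctor : F ≅ _)
  exact ⟨h2⟩

instance sg_preserves : PreservesColimitsOfShape (Discrete ι)
    (DerivedCategory.singleFunctor (ModuleCat.{u} A) 0) := by
  change PreservesColimitsOfShape (Discrete ι) (HomologicalComplex.single (ModuleCat.{u} A) (ComplexShape.up ℤ) 0 ⋙ DerivedCategory.Q)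
  infer_instance


instance sg_preservesLim : PreservesLimitsOfShape (Discrete ι)
    (DerivedCategory.singleFunctor (ModuleCat.{u} A) 0) := by
  change PreservesLimitsOfShape (Discrete ι) (HomologicalComplex.single (ModuleCat.{u} A) (ComplexShape.up ℤ) 0 ⋙ DerivedCategory.Q)
  infer_instance


end coprodD
end Tele

namespace Tele
section homs
variable {A : Type u} [Ring A] [HasDerivedCategory.{w} (ModuleCat.{u} A)]

/-- modules in degree 0 -/
noncomputable abbrev sg : ModuleCat.{u} A ⥤ DD A := DerivedCategory.singleFunctor (ModuleCat.{u} A) 0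
noncomputable abbrev H0 : DD A ⥤ ModuleCat.{u} A := DerivedCategory.homologyFunctor (ModuleCat.{u} A) 0

open HomologicalComplex in
noncomputable def rho (M : ModuleCat.{u} A) : M ⟶ H0.obj (sg.obj M) :=
  (singleObjHomologySelfIso (ComplexShape.up ℤ) 0 M).inv ≫
      (DerivedCategory.homologyFunctorFactors (ModuleCat.{u} A) 0).inv.app _

noncomputable def qmap {M : ModuleCat.{u} A} {K : CC A}
    (f : (HomologicalComplex.single (ModuleCat.{u} A) (ComplexShape.up ℤ) 0).obj M ⟶ K) :
    sg.obj M ⟶ DerivedCategory.Q.obj K := DerivedCategory.Q.map f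

open HomologicalComplex in
theorem rho_nat {M N : ModuleCat.{u} A} (g : M ⟶ N) : rho M ≫ H0.map (sg.map g) = g ≫ rho N := by
  have h1 := (DerivedCategory.homologyFunctorFactors (ModuleCat.{u} A) 0).inv.naturality
    ((single (ModuleCat.{u} A) (ComplexShape.up ℤ) 0).map g)
  have h2 := (homologyFunctorSingleIso (ModuleCat.{u} A) (ComplexShape.up ℤ) 0).inv.naturality g
  refine (Category.assoc _ _ _).trans ?_
  refine (congrArg (_ ≫ ·) h1.symm).trans ?_
  refine (Category.assoc _ _ _).symm.trans ?_
  refine (congrArg (· ≫ _) h2.symm).trans ?_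
  exact Category.assoc _ _ _

theorem isIso_rho (M : ModuleCat.{u} A) : IsIso (rho M) := by
  have h1 : IsIso ((DerivedCategory.homologyFunctorFactors (ModuleCat.{u} A) 0).inv.app
    ((HomologicalComplex.single (ModuleCat.{u} A) (ComplexShape.up ℤ) 0).obj M)) := inferInstance
  exact @IsIso.comp_isIso _ _ _ _ _ _ _ inferInstance h1

noncomputable def hmap {M : ModuleCat.{u} A} {X : DD A} (φ : sg.obj M ⟶ X) : M ⟶ H0.obj X :=
  rho M ≫ H0.map φ

theorem hmap_comp {M : ModuleCat.{u} A} {X Y : DD A} (φ : sg.obj M ⟶ X) (f : X ⟶ Y) :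
    hmap (φ ≫ f) = hmap φ ≫ H0.map f := by
  simp [hmap]

theorem hmap_pre {M N : ModuleCat.{u} A} {X : DD A} (g : M ⟶ N) (φ : sg.obj N ⟶ X) :
    hmap (sg.map g ≫ φ) = g ≫ hmap φ := by
  simp only [hmap, Functor.map_comp]
  rw [← Category.assoc, ← Category.assoc, rho_nat]

theorem hmap_zero {M : ModuleCat.{u} A} {X : DD A} : hmap (0 : sg.obj M ⟶ X) = 0 := by
  simp [hmap]

theorem hmap_sub {M : ModuleCat.{u} A} {X : DD A} (φ ψ : sg.obj M ⟶ X) :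
    hmap (φ - ψ) = hmap φ - hmap ψ := by
  simp [hmap, Functor.map_sub]

theorem isIso_hmap_id (M : ModuleCat.{u} A) : IsIso (hmap (𝟙 (sg.obj M))) := by
  have := isIso_rho M
  simp only [hmap, Functor.map_id]
  infer_instance

theorem single_kproj (P : ModuleCat.{u} A) [Projective P] :
    CochainComplex.IsKProjective ((HomologicalComplex.single (ModuleCat.{u} A) (ComplexShape.up ℤ) 0).obj P) := by
  have : ∀ n : ℤ, Projective (((HomologicalComplex.single (ModuleCat.{u} A) (ComplexShape.up ℤ) 0).obj P).X n) := by
    intro n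
    by_cases hn : n = 0
    · subst hn
      exact Projective.of_iso (HomologicalComplex.singleObjXSelf (ComplexShape.up ℤ) 0 P).symm inferInstance
    · exact (HomologicalComplex.isZero_single_obj_X (ComplexShape.up ℤ) 0 P n hn).projective
  exact CochainComplex.isKProjective_of_projective _ 0

open DerivedCategory in
theorem exists_chain (P : ModuleCat.{u} A) [Projective P] (K : CC A) (φ : sg.obj P ⟶ Q.obj K) :
    ∃ f : (HomologicalComplex.single (ModuleCat.{u} A) (ComplexShape.up ℤ) 0).obj P ⟶ K,
      qmap f = φ := by
  have := single_kproj P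
  obtain ⟨g, hg⟩ := (CochainComplex.IsKProjective.Qh_map_bijective
    ((HomologicalComplex.single (ModuleCat.{u} A) (ComplexShape.up ℤ) 0).obj P)
    ((HomotopyCategory.quotient _ _).obj K)).2 φ
  obtain ⟨f, rfl⟩ := (HomotopyCategory.quotient _ _).map_surjective g
  exact ⟨f, hg⟩

open HomologicalComplex in
theorem hmap_Q {M : ModuleCat.{u} A} {K : CC A} (f : (single (ModuleCat.{u} A) (ComplexShape.up ℤ) 0).obj M ⟶ K) :
    hmap (qmap f) ≫ (DerivedCategory.homologyFunctorFactors (ModuleCat.{u} A) 0).hom.app K =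
      ((singleObjCyclesSelfIso (ComplexShape.up ℤ) 0 M).inv ≫ cyclesMap f 0) ≫ K.homologyπ 0 := by
  rw [Category.assoc, ← homologyπ_naturality, ← Category.assoc, singleObjCyclesSelfIso_inv_homologyπ,
    hmap, rho, Category.assoc]
  refine (Category.assoc _ _ _).trans ?_
  congr 1
  have h2 := DerivedCategory.homologyFunctorFactors_hom_naturality (C := ModuleCat.{u} A) f 0
  refine (congrArg (_ ≫ ·) h2).trans ?_
  exact (((DerivedCategory.homologyFunctorFactors (ModuleCat.{u} A) 0).app
    ((single (ModuleCat.{u} A) (ComplexShape.up ℤ) 0).obj M)).inv_hom_id_assoc _)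

theorem hmap_surj (P : ModuleCat.{u} A) [Projective P] (X : DD A) (g : P ⟶ H0.obj X) :
    ∃ φ : sg.obj P ⟶ X, hmap φ = g := by
  obtain ⟨K, ⟨e⟩⟩ : ∃ Y' : CC A, Nonempty (DerivedCategory.Q.obj Y' ≅ X) := ⟨_, ⟨DerivedCategory.Q.objObjPreimageIso X⟩⟩
  let g' : P ⟶ K.homology 0 := g ≫ H0.map e.inv ≫ (DerivedCategory.homologyFunctorFactors (ModuleCat.{u} A) 0).hom.app K
  let c : P ⟶ K.cycles 0 := Projective.factorThru g' (K.homologyπ 0)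
  have hc : c ≫ K.homologyπ 0 = g' := Projective.factorThru_comp _ _
  let f : (HomologicalComplex.single (ModuleCat.{u} A) (ComplexShape.up ℤ) 0).obj P ⟶ K :=
    HomologicalComplex.mkHomFromSingle (c ≫ K.iCycles 0) (fun k _ => by simp)
  have hf : (HomologicalComplex.singleObjCyclesSelfIso (ComplexShape.up ℤ) 0 P).inv ≫ HomologicalComplex.cyclesMap f 0 = c := by
    rw [← cancel_mono (K.iCycles 0), Category.assoc, HomologicalComplex.cyclesMap_i,
      ← Category.assoc, HomologicalComplex.singleObjCyclesSelfIso_inv_iCycles,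
      HomologicalComplex.mkHomFromSingle_f, Iso.inv_hom_id_assoc]
  refine ⟨qmap f ≫ e.hom, ?_⟩
  have h1 := hmap_Q f
  rw [hf, hc] at h1
  rw [hmap_comp]
  have h2 : hmap (qmap f) = g ≫ H0.map e.inv := by
    have hm : IsIso ((DerivedCategory.homologyFunctorFactors (ModuleCat.{u} A) 0).hom.app K) := inferInstance
    refine (@cancel_mono _ _ _ _ _ _ (@IsIso.mono_of_iso _ _ _ _ _ hm) _ _).1 ?_
    refine h1.trans ?_
    simp only [g', Category.assoc]
    rfl
  refine (congrArg (· ≫ H0.map e.hom) h2).trans ?_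
  rw [Category.assoc, ← Functor.map_comp, e.inv_hom_id, CategoryTheory.Functor.map_id, Category.comp_id]

open CochainComplex.HomComplex in
theorem hmap_inj (P : ModuleCat.{u} A) [Projective P] (X : DD A) (φ : sg.obj P ⟶ X)
    (h : hmap φ = 0) : φ = 0 := by
  obtain ⟨K, ⟨e⟩⟩ : ∃ Y' : CC A, Nonempty (DerivedCategory.Q.obj Y' ≅ X) := ⟨_, ⟨DerivedCategory.Q.objObjPreimageIso X⟩⟩
  obtain ⟨f, hf⟩ := exists_chain P K (φ ≫ e.inv)
  have h1 := hmap_Q f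
  have h0 : hmap (qmap f) = 0 := by
    rw [hf, hmap_comp, h, zero_comp]
  rw [h0, zero_comp] at h1
  let c := (HomologicalComplex.singleObjCyclesSelfIso (ComplexShape.up ℤ) 0 P).inv ≫ HomologicalComplex.cyclesMap f 0
  have hex := ShortComplex.exact_of_g_is_cokernel
    (ShortComplex.mk (K.toCycles (-1) 0) (K.homologyπ 0) (by simp))
    (K.homologyIsCokernel (-1) 0 (by simp))
  obtain ⟨s, hs⟩ : ∃ s : P ⟶ K.X (-1), s ≫ K.toCycles (-1) 0 = c := ⟨hex.liftFromProjective c h1.symm, hex.liftFromProjective_comp c h1.symm⟩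
  have hs' : (HomologicalComplex.singleObjXSelf (ComplexShape.up ℤ) 0 P).hom ≫ s ≫ K.d (-1) 0 = f.f 0 := by
    rw [← K.toCycles_i (-1) 0, reassoc_of% hs, Category.assoc, HomologicalComplex.cyclesMap_i,
      HomologicalComplex.singleObjCyclesSelfIso_inv_iCycles_assoc, Iso.hom_inv_id_assoc]
  let z : Cochain ((HomologicalComplex.single (ModuleCat.{u} A) (ComplexShape.up ℤ) 0).obj P) K (-1) :=
    Cochain.single ((HomologicalComplex.singleObjXSelf (ComplexShape.up ℤ) 0 P).hom ≫ s) (-1)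
  have ho : Homotopy f 0 := (Cochain.equivHomotopy f 0).symm ⟨z, by
    rw [Cochain.δ_single _ (-1) 0 (by simp) (-1) 0 (by simp) (by simp)]
    have hd : ((HomologicalComplex.single (ModuleCat.{u} A) (ComplexShape.up ℤ) 0).obj P).d (-1) 0 = 0 := 
      (HomologicalComplex.isZero_single_obj_X (ComplexShape.up ℤ) 0 P (-1) (by simp)).eq_of_src _ _
    rw [hd, zero_comp, Cochain.single_zero, smul_zero, add_zero, Cochain.ofHom_zero, add_zero,
      Category.assoc, hs']
    refine Cochain.ext₀ _ _ fun p => ?_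
    by_cases hp : p = 0
    · subst hp
      rw [Cochain.single_v, Cochain.ofHom_v]
    · exact (HomologicalComplex.isZero_single_obj_X (ComplexShape.up ℤ) 0 P p hp).eq_of_src _ _⟩
  have hq := DerivedCategory.Q_map_eq_of_homotopy _ ho
  replace hq := hf.symm.trans (hq.trans (Functor.map_zero _ _ _))
  rw [← cancel_mono e.inv, zero_comp]
  exact hq

/-- compactness -/
def IsCpt (s : DD A) : Prop :=
  ∀ (ι : Type u) (g : ι → DD A) (c : Cofan g), IsColimit c → ∀ f : s ⟶ c.pt,
    ∃ (t : Finset ι) (h : ∀ i, s ⟶ g i), f = ∑ i ∈ t, h i ≫ c.inj i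

theorem isCpt_of_iso {s s' : DD A} (e : s ≅ s') (h : IsCpt s) : IsCpt s' := by
  intro ι g c hc f
  obtain ⟨t, h, hf⟩ := h ι g c hc (e.hom ≫ f)
  refine ⟨t, fun i => e.inv ≫ h i, ?_⟩
  rw [← cancel_epi e.hom, hf, Preadditive.comp_sum]
  simp

/-- it suffices to check on concrete coproducts -/
theorem isCpt_of_conc {s : DD A} (h : ∀ (ι : Type u) (K : ι → CC A) (f : s ⟶ DerivedCategory.Q.obj (dsumC K)),
    ∃ (t : Finset ι) (h : ∀ i, s ⟶ DerivedCategory.Q.obj (K i)),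
      f = ∑ i ∈ t, h i ≫ DerivedCategory.Q.map (dsumι K i)) : IsCpt s := by
  intro ι g c hc f
  let K : ι → CC A := fun i => DerivedCategory.Q.objPreimage (g i)
  let e : ∀ i, DerivedCategory.Q.obj (K i) ≅ g i := fun i => DerivedCategory.Q.objObjPreimageIso _
  let a : c.pt ⟶ DerivedCategory.Q.obj (dsumC K) :=
    Cofan.IsColimit.desc hc (fun i => (e i).inv ≫ DerivedCategory.Q.map (dsumι K i))
  let b : DerivedCategory.Q.obj (dsumC K) ⟶ c.pt :=
    Cofan.IsColimit.desc (QdsumIsColimit K) (fun i => (e i).hom ≫ c.inj i)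
  have ha : ∀ i, c.inj i ≫ a = (e i).inv ≫ DerivedCategory.Q.map (dsumι K i) := fun i =>
    Cofan.IsColimit.fac hc _ i
  have hb : ∀ i, DerivedCategory.Q.map (dsumι K i) ≫ b = (e i).hom ≫ c.inj i := fun i =>
    Cofan.IsColimit.fac (QdsumIsColimit K) _ i
  have hab : a ≫ b = 𝟙 _ := by
    refine Cofan.IsColimit.hom_ext hc _ _ fun i => ?_
    rw [← Category.assoc, ha, Category.assoc, hb, Iso.inv_hom_id_assoc, Category.comp_id]
  obtain ⟨t, k, hk⟩ := h ι K (f ≫ a)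
  refine ⟨t, fun i => k i ≫ (e i).hom, ?_⟩
  have : f = (f ≫ a) ≫ b := by rw [Category.assoc, hab, Category.comp_id]
  rw [this, hk, Preadditive.sum_comp]
  refine Finset.sum_congr rfl fun i _ => ?_
  rw [Category.assoc, hb, Category.assoc]

theorem isCpt_sg (P : ModuleCat.{u} A) [Projective P] (hP : Module.Finite A P) :
    IsCpt (sg.obj P) := by
  classical
  refine isCpt_of_conc fun ι K f => ?_
  obtain ⟨f, rfl⟩ := exists_chain P _ f
  let pr : ∀ i, dsumC K ⟶ K i := fun i =>
    dsumDesc K (K i) (fun j => if h : j = i then eqToHom (by rw [h]) else 0)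
  have hpr : ∀ i n (x : Π₀ i, (K i).X n), (pr i).f n x = x i := by
    intro i n x
    induction x using DFinsupp.induction with
    | h0 => exact map_zero ((pr i).f n).hom
    | ha j b t _ _ ih =>
      refine (map_add ((pr i).f n).hom _ _).trans ?_
      rw [DFinsupp.add_apply]
      refine congrArg₂ _ ?_ ih
      have h1 := congr_elem n b (dsumι_desc K (K i) (fun j => if h : j = i then eqToHom (by rw [h]) else 0) j)
      refine h1.trans ?_
      by_cases h : j = i
      · subst h
        simp
      · rw [dif_neg h, DFinsupp.single_eq_of_ne (Ne.symm h)]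
        rfl
  let u : P ⟶ (dsumC K).X 0 := (HomologicalComplex.singleObjXSelf (ComplexShape.up ℤ) 0 P).inv ≫ f.f 0
  have hu : ∃ t : Finset ι, ∀ x i, i ∉ t → (show Π₀ i, (K i).X 0 from u x) i = 0 := by
    obtain ⟨S, hS⟩ := hP
    refine ⟨S.biUnion (fun x => (show Π₀ i, (K i).X 0 from u x).support), fun x i hi => ?_⟩
    have hx : x ∈ Submodule.span A (S : Set P) := by rw [hS]; trivial
    induction hx using Submodule.span_induction with
    | mem x hx =>
      by_contra hne
      exact hi (Finset.mem_biUnion.2 ⟨x, hx, (DFinsupp.mem_support_toFun (β := fun i => (K i).X 0) _ _).2 hne⟩)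
    | zero => exact congrArg (fun z => DFunLike.coe (F := Π₀ i, (K i).X 0) z i) (map_zero u.hom)
    | add x y _ _ hx hy =>
      refine (congrArg (fun z => DFunLike.coe (F := Π₀ i, (K i).X 0) z i) (map_add u.hom x y)).trans ?_
      refine (congrArg₂ (· + ·) hx hy).trans (add_zero _)
    | smul a x _ hx =>
      refine (congrArg (fun z => DFunLike.coe (F := Π₀ i, (K i).X 0) z i) (map_smul u.hom a x)).trans ?_
      refine (congrArg (a • ·) hx).trans (smul_zero _)
  obtain ⟨t, ht⟩ := hu
  refine ⟨t, fun i => qmap (f ≫ pr i), ?_⟩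
  change DerivedCategory.Q.map f = ∑ i ∈ t, DerivedCategory.Q.map (f ≫ pr i) ≫ _
  simp only [← Functor.map_comp]
  rw [← Functor.map_sum]
  congr 1
  refine HomologicalComplex.from_single_hom_ext ?_
  rw [← cancel_epi (HomologicalComplex.singleObjXSelf (ComplexShape.up ℤ) 0 P).inv]
  change u = _
  refine ModuleCat.hom_ext (LinearMap.ext fun x => ?_)
  refine DFinsupp.ext (β := fun i => (K i).X 0) fun i => ?_
  have hsum : ((HomologicalComplex.singleObjXSelf (ComplexShape.up ℤ) 0 P).inv ≫
      (∑ i ∈ t, (f ≫ pr i) ≫ dsumι K i).f 0) = ∑ i ∈ t, u ≫ (pr i).f 0 ≫ (dsumι K i).f 0 := by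
    rw [show ∀ F : ι → (_ ⟶ dsumC K), (∑ i ∈ t, F i).f 0 = ∑ i ∈ t, (F i).f 0 from
      fun F => map_sum (HomologicalComplex.Hom.fAddMonoidHom (C₁ := (HomologicalComplex.single (ModuleCat.{u} A) (ComplexShape.up ℤ) 0).obj P) (C₂ := dsumC K) 0) F t, Preadditive.comp_sum]
    refine Finset.sum_congr rfl fun i _ => ?_
    simp [u]
  rw [hsum]
  have e1 : ∀ j, (u ≫ (pr j).f 0 ≫ (dsumι K j).f 0).hom x =
    (DFinsupp.single j ((show Π₀ i, (K i).X 0 from u x) j) : Π₀ i, (K i).X 0) := fun j =>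
      congrArg (fun z => (DFinsupp.single j z : Π₀ i, (K i).X 0)) (hpr j 0 _)
  have e2 : (∑ i ∈ t, u ≫ (pr i).f 0 ≫ (dsumι K i).f 0).hom x =
      (∑ j ∈ t, DFinsupp.single j ((show Π₀ i, (K i).X 0 from u x) j) : Π₀ i, (K i).X 0) := by
    rw [ModuleCat.hom_sum, LinearMap.sum_apply]
    exact Finset.sum_congr rfl fun j _ => e1 j
  refine Eq.trans ?_ (congrArg (fun z => DFunLike.coe (F := Π₀ i, (K i).X 0) z i) e2).symm
  rw [DFinsupp.finset_sum_apply]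
  by_cases hi : i ∈ t
  · rw [Finset.sum_eq_single i]
    · rw [DFinsupp.single_eq_same]
    · intro j _ hj
      rw [DFinsupp.single_eq_of_ne (Ne.symm hj)]
    · exact fun h => (h hi).elim
  · rw [Finset.sum_eq_zero]
    · exact ht x i hi
    · intro j hj
      rw [DFinsupp.single_eq_of_ne]
      rintro rfl
      exact hi hj

end homs
end Tele

namespace Tele
section cpt
variable {A : Type u} [Ring A] [HasDerivedCategory.{w} (ModuleCat.{u} A)]

theorem isCpt_of_closure {s : DD A}
    (H : ∀ (ι : Type u) (g : ι → DD A) (c : Cofan g), IsColimit c → ∀ f : s ⟶ c.pt,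
      f ∈ AddSubgroup.closure {x : s ⟶ c.pt | ∃ (i : ι) (h : s ⟶ g i), x = h ≫ c.inj i}) : IsCpt s := by
  classical
  intro ι g c hc f
  have hf := H ι g c hc f
  clear H
  induction hf using AddSubgroup.closure_induction with
  | mem x hx =>
    obtain ⟨i, h, rfl⟩ := hx
    refine ⟨{i}, fun j => if e : i = j then h ≫ eqToHom (by rw [e]) else 0, ?_⟩
    simp
  | zero => exact ⟨∅, fun _ => 0, by simp⟩
  | add x y _ _ hx hy =>
    obtain ⟨t, h, rfl⟩ := hx
    obtain ⟨t', h', rfl⟩ := hy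
    refine ⟨t ∪ t', fun i => (if i ∈ t then h i else 0) + (if i ∈ t' then h' i else 0), ?_⟩
    simp only [Preadditive.add_comp, Finset.sum_add_distrib, ite_comp, zero_comp]
    rw [Finset.sum_ite_mem, Finset.sum_ite_mem, Finset.union_inter_cancel_left, Finset.union_inter_cancel_right]
  | neg x _ hx =>
    obtain ⟨t, h, rfl⟩ := hx
    exact ⟨t, fun i => - h i, by simp⟩

theorem IsCpt.closure {s : DD A} (hs : IsCpt s) {ι : Type u} {g : ι → DD A} {c : Cofan g} (hc : IsColimit c)
    (f : s ⟶ c.pt) :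
    f ∈ AddSubgroup.closure {x : s ⟶ c.pt | ∃ (i : ι) (h : s ⟶ g i), x = h ≫ c.inj i} := by
  obtain ⟨t, h, rfl⟩ := hs ι g c hc f
  exact AddSubgroup.sum_mem _ fun i _ => AddSubgroup.subset_closure ⟨i, h i, rfl⟩

noncomputable def mapCofan {C D : Type*} [Category* C] [Category* D] (F : C ⥤ D) {ι : Type*}
    [PreservesColimitsOfShape (Discrete ι) F] {g : ι → C} (c : Cofan g) (hc : IsColimit c) :
    IsColimit (Cofan.mk (F.obj c.pt) (fun i => F.map (c.inj i))) :=
  isColimitCofanMkObjOfIsColimit F _ c.inj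
    (hc.ofIsoColimit (Cofan.ext (Iso.refl _) (fun i => by simp)))

theorem isCpt_shift {s : DD A} (hs : IsCpt s) (n : ℤ) : IsCpt (s⟦n⟧) := by
  intro ι g c hc f
  obtain ⟨t, h, hf⟩ := hs ι _ _ (mapCofan (shiftFunctor (DD A) (-n)) c hc)
    ((shiftFunctorCompIsoId (DD A) n (-n) (by simp)).inv.app s ≫ f⟦-n⟧')
  choose k hk using fun i => (shiftFunctor (DD A) (-n)).map_surjective
    ((shiftFunctorCompIsoId (DD A) n (-n) (by simp)).hom.app s ≫ h i)
  refine ⟨t, k, (shiftFunctor (DD A) (-n)).map_injective ?_⟩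
  rw [← cancel_epi ((shiftFunctorCompIsoId (DD A) n (-n) (by simp)).inv.app s)]
  refine hf.trans ?_
  rw [Functor.map_sum, Preadditive.comp_sum]
  refine Finset.sum_congr rfl fun i _ => ?_
  rw [Functor.map_comp, hk, Category.assoc, Iso.inv_hom_id_app_assoc]
  rfl

open Classical in
noncomputable def cpr {ι : Type u} {g : ι → DD A} {c : Cofan g} (hc : IsColimit c) (i : ι) : c.pt ⟶ g i :=
  Cofan.IsColimit.desc hc (fun j => if h : j = i then eqToHom (by rw [h]) else 0)

theorem inj_cpr {ι : Type u} {g : ι → DD A} {c : Cofan g} (hc : IsColimit c) (i : ι) :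
    c.inj i ≫ cpr hc i = 𝟙 _ := by
  simp [cpr]

theorem inj_cpr_ne {ι : Type u} {g : ι → DD A} {c : Cofan g} (hc : IsColimit c) {i j : ι} (h : j ≠ i) :
    c.inj j ≫ cpr hc i = 0 := by
  simp [cpr, h]

theorem sum_cpr {s : DD A} {ι : Type u} {g : ι → DD A} {c : Cofan g} (hc : IsColimit c) (t : Finset ι)
    (h : ∀ i, s ⟶ g i) (j : ι) (hj : j ∈ t) : (∑ i ∈ t, h i ≫ c.inj i) ≫ cpr hc j = h j := by
  rw [Preadditive.sum_comp, Finset.sum_eq_single j]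
  · rw [Category.assoc, inj_cpr, Category.comp_id]
  · intro b _ hb
    rw [Category.assoc, inj_cpr_ne hc hb, comp_zero]
  · exact fun h => (h hj).elim

theorem isCpt_cone (T : Triangle (DD A)) (hT : T ∈ distTriang (DD A)) (h₁ : IsCpt T.obj₁)
    (h₂ : IsCpt T.obj₂) : IsCpt T.obj₃ := by
  refine isCpt_of_closure fun ι g c hc f => ?_
  obtain ⟨t, h, hf⟩ := h₂ ι g c hc (T.mor₂ ≫ f)
  have hz : ∀ j ∈ t, ∃ k, h j = T.mor₂ ≫ k := by
    intro j hj
    refine T.yoneda_exact₂ hT _ ?_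
    rw [← sum_cpr hc t h j hj, ← hf, ← Category.assoc, ← Category.assoc, comp_distTriang_mor_zero₁₂ _ hT, zero_comp, zero_comp]
  have hz' : ∀ j, ∃ k, j ∈ t → h j = T.mor₂ ≫ k := by
    intro j
    by_cases hj : j ∈ t
    · obtain ⟨k, hk⟩ := hz j hj; exact ⟨k, fun _ => hk⟩
    · exact ⟨0, fun h => (hj h).elim⟩
  choose k hk using hz'
  have h3 : T.mor₂ ≫ (f - ∑ i ∈ t, k i ≫ c.inj i) = 0 := by
    rw [Preadditive.comp_sub, hf, Preadditive.comp_sum, sub_eq_zero]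
    refine Finset.sum_congr rfl fun i hi => ?_
    rw [← Category.assoc, ← hk i hi]
  obtain ⟨r, hr⟩ := T.yoneda_exact₃ hT _ h3
  have h4 := (isCpt_shift h₁ 1).closure hc r
  have h5 : f = T.mor₃ ≫ r + ∑ i ∈ t, k i ≫ c.inj i := by rw [← hr]; abel
  rw [h5]
  refine AddSubgroup.add_mem _ ?_ (AddSubgroup.sum_mem _ fun i _ => AddSubgroup.subset_closure ⟨i, _, rfl⟩)
  clear h5 hr
  induction h4 using AddSubgroup.closure_induction with
  | mem x hx =>
    obtain ⟨i, h, rfl⟩ := hx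
    exact AddSubgroup.subset_closure ⟨i, T.mor₃ ≫ h, by simp⟩
  | zero => simp [AddSubgroup.zero_mem]
  | add x y _ _ hx hy => rw [Preadditive.comp_add]; exact AddSubgroup.add_mem _ hx hy
  | neg x _ hx => rw [Preadditive.comp_neg]; exact AddSubgroup.neg_mem _ hx

/-- shift closed family -/
def ShiftClosed {ι : Type u} (S : ι → DD A) : Prop := ∀ (i : ι) (n : ℤ), ∃ j, Nonempty (S j ≅ (S i)⟦n⟧)

theorem cone_orth {ι : Type u} (S : ι → DD A) (hS : ShiftClosed S) (T : Triangle (DD A))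
    (hT : T ∈ distTriang (DD A))
    (hsurj : ∀ i (g : S i ⟶ T.obj₂), ∃ h, h ≫ T.mor₁ = g)
    (hinj : ∀ i (h : S i ⟶ T.obj₁), h ≫ T.mor₁ = 0 → h = 0) (i : ι) (g : S i ⟶ T.obj₃) : g = 0 := by
  have h1 : g ≫ T.mor₃ = 0 := by
    obtain ⟨j, ⟨e⟩⟩ := hS i (-1)
    obtain ⟨k, hk⟩ := (shiftFunctor (DD A) (1 : ℤ)).map_surjective
      ((shiftFunctorCompIsoId (DD A) (-1 : ℤ) 1 (by simp)).hom.app (S i) ≫ g ≫ T.mor₃)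
    have hk0 : e.hom ≫ k = 0 := by
      refine hinj j _ ?_
      rw [Category.assoc, (?_ : k ≫ T.mor₁ = 0), comp_zero]
      refine (shiftFunctor (DD A) (1 : ℤ)).map_injective ?_
      rw [Functor.map_comp, hk, Functor.map_zero, Category.assoc, Category.assoc, comp_distTriang_mor_zero₃₁ _ hT,
        comp_zero, comp_zero]
    have hk1 : k = 0 := by rw [← cancel_epi e.hom, hk0, comp_zero]
    rw [hk1, Functor.map_zero] at hk
    rw [← cancel_epi ((shiftFunctorCompIsoId (DD A) (-1 : ℤ) 1 (by simp)).hom.app (S i)), ← hk, comp_zero]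
  obtain ⟨g', hg'⟩ := T.coyoneda_exact₃ hT g h1
  obtain ⟨h, hh⟩ := hsurj i g'
  rw [hg', ← hh, Category.assoc, comp_distTriang_mor_zero₁₂ _ hT, comp_zero]

theorem isIso_of_detect {ι : Type u} (S : ι → DD A) (hS : ShiftClosed S)
    (hd : ∀ Y, (∀ i (f : S i ⟶ Y), f = 0) → IsZero Y) {X Y : DD A} (f : X ⟶ Y)
    (hsurj : ∀ i (g : S i ⟶ Y), ∃ h, h ≫ f = g)
    (hinj : ∀ i (h : S i ⟶ X), h ≫ f = 0 → h = 0) : IsIso f := by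
  obtain ⟨Z, g, h, hT⟩ := distinguished_cocone_triangle f
  exact (Triangle.isZero₃_iff_isIso₁ _ hT).1 (hd Z (cone_orth S hS _ hT hsurj hinj))

end cpt
end Tele

namespace Tele
section bous
variable {A : Type u} [Ring A] [HasDerivedCategory.{w} (ModuleCat.{u} A)]

theorem exists_coprod {ι : Type u} (g : ι → DD A) : ∃ c : Cofan g, Nonempty (IsColimit c) :=
  ⟨_, ⟨coproductIsCoproduct g⟩⟩

/-- `W` lies in each localizing subcategory containing the family -/
def InLoc {ι : Type u} (S : ι → DD A) (W : DD A) : Prop :=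
  ∀ 𝒟 : Set (DD A), IsLocalizingSubcategory 𝒟 → (∀ i, S i ∈ 𝒟) → W ∈ 𝒟

structure Stg {ι : Type u} (S : ι → DD A) (X : DD A) where
  W : DD A
  p : W ⟶ X
  mem : InLoc S W

variable {ι : Type u} (S : ι → DD A)

theorem stg_start (hsm : ∀ i X, Small.{u} (S i ⟶ X)) (X : DD A) : ∃ s : Stg S X, ∀ i (g : S i ⟶ X), ∃ h, h ≫ s.p = g := by
  obtain ⟨c, ⟨hc⟩⟩ := exists_coprod (fun k : Σ i, Shrink.{u} (S i ⟶ X) => S k.1)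
  refine ⟨⟨c.pt, Cofan.IsColimit.desc hc (fun k => (equivShrink _).symm k.2),
    fun 𝒟 h𝒟 hS => h𝒟.2.2.2.2.2 _ _ c hc fun k => hS _⟩, fun i g => ?_⟩
  exact ⟨c.inj ⟨i, equivShrink _ g⟩, by simp⟩

theorem stg_step (hsm : ∀ i X, Small.{u} (S i ⟶ X)) (X : DD A) (s : Stg S X) : ∃ (s' : Stg S X) (φ : s.W ⟶ s'.W), φ ≫ s'.p = s.p ∧
    ∀ i (h : S i ⟶ s.W), h ≫ s.p = 0 → h ≫ φ = 0 := by
  obtain ⟨c, ⟨hc⟩⟩ := exists_coprod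
    (fun k : Σ i, Shrink.{u} {h : S i ⟶ s.W // h ≫ s.p = 0} => S k.1)
  let d : c.pt ⟶ s.W := Cofan.IsColimit.desc hc (fun k => ((equivShrink _).symm k.2).1)
  have hd : ∀ k, c.inj k ≫ d = ((equivShrink _).symm k.2).1 := fun k => by simp [d]
  obtain ⟨Z, φ, δ, hT⟩ := distinguished_cocone_triangle d
  have h0 : d ≫ s.p = 0 := by
    refine Cofan.IsColimit.hom_ext hc _ _ fun k => ?_
    rw [← Category.assoc, hd, comp_zero]
    exact ((equivShrink _).symm k.2).2
  obtain ⟨p, hp⟩ := Triangle.yoneda_exact₂ _ hT s.p h0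
  refine ⟨⟨Z, p, fun 𝒟 h𝒟 hS => h𝒟.2.2.2.1 _ hT (h𝒟.2.2.2.2.2 _ _ c hc fun k => hS _) (s.mem 𝒟 h𝒟 hS)⟩, φ, hp.symm, ?_⟩
  intro i h hh
  have h1 := hd ⟨i, equivShrink _ ⟨h, hh⟩⟩
  rw [Equiv.symm_apply_apply] at h1
  change _ = h at h1
  rw [← h1, Category.assoc]
  have := comp_distTriang_mor_zero₁₂ _ hT
  change d ≫ φ = 0 at this
  rw [this, comp_zero]

theorem bousfield (hsm : ∀ i X, Small.{u} (S i ⟶ X)) (hS : ShiftClosed S) (hcpt : ∀ i, IsCpt (S i)) (X : DD A) :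
    ∃ (W V : DD A) (f : W ⟶ X) (g : X ⟶ V) (h : V ⟶ W⟦(1 : ℤ)⟧), Triangle.mk f g h ∈ distTriang (DD A) ∧
      InLoc S W ∧ ∀ i (k : S i ⟶ V), k = 0 := by
  obtain ⟨s0, hs0⟩ := stg_start S hsm X
  choose nx φ hφ hφ0 using stg_step S hsm X
  let sq : ℕ → Stg S X := fun n => Nat.rec s0 (fun _ s => nx s) n
  let ψ : ∀ n, (sq n).W ⟶ (sq (n+1)).W := fun n => φ (sq n)
  have hψ : ∀ n, ψ n ≫ (sq (n+1)).p = (sq n).p := fun n => hφ (sq n)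
  have hψ0 : ∀ n i (h : S i ⟶ (sq n).W), h ≫ (sq n).p = 0 → h ≫ ψ n = 0 := fun n => hφ0 (sq n)
  obtain ⟨c, ⟨hc⟩⟩ := exists_coprod (fun n : ULift.{u} ℕ => (sq n.down).W)
  let inj : ∀ n : ℕ, (sq n).W ⟶ c.pt := fun n => c.inj ⟨n⟩
  let sh : c.pt ⟶ c.pt := Cofan.IsColimit.desc hc (fun n => inj n.down - ψ n.down ≫ inj (n.down + 1))
  have hsh : ∀ n, inj n ≫ sh = inj n - ψ n ≫ inj (n+1) := fun n => Cofan.IsColimit.fac hc _ _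
  obtain ⟨W, π, δ, hT⟩ := distinguished_cocone_triangle sh
  have z12 : sh ≫ π = 0 := comp_distTriang_mor_zero₁₂ _ hT
  have hpi : ∀ n, inj n ≫ π = ψ n ≫ inj (n+1) ≫ π := by
    intro n
    have := congrArg (· ≫ π) (hsh n)
    simp only [Category.assoc, z12, comp_zero, Preadditive.sub_comp] at this
    exact (sub_eq_zero.1 this.symm)
  let q : c.pt ⟶ X := Cofan.IsColimit.desc hc (fun n => (sq n.down).p)
  have hq : ∀ n, inj n ≫ q = (sq n).p := fun n => Cofan.IsColimit.fac hc _ _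
  have hshq : sh ≫ q = 0 := by
    refine Cofan.IsColimit.hom_ext hc _ _ fun n => ?_
    change inj n.down ≫ sh ≫ q = inj n.down ≫ 0
    rw [← Category.assoc, hsh, Preadditive.sub_comp, Category.assoc, hq, hq, hψ, sub_self, comp_zero]
  obtain ⟨p, hp⟩ : ∃ p : W ⟶ X, q = π ≫ p := Triangle.yoneda_exact₂ _ hT q hshq
  -- injectivity of `sh` on maps from compact objects
  have shinj : ∀ s : DD A, IsCpt s → ∀ f : s ⟶ c.pt, f ≫ sh = 0 → f = 0 := by
    intro s hs f hf
    obtain ⟨t, h, hft⟩ := hs _ _ c hc f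
    have hpr0 : inj 0 ≫ cpr hc ⟨0⟩ = 𝟙 _ := inj_cpr hc _
    have key : ∀ n, f ≫ cpr hc ⟨n⟩ = 0 := by
      intro n
      induction n with
      | zero =>
        have e : sh ≫ cpr hc ⟨0⟩ = cpr hc ⟨0⟩ := by
          refine Cofan.IsColimit.hom_ext hc _ _ fun n => ?_
          change inj n.down ≫ sh ≫ _ = _
          rw [← Category.assoc, hsh, Preadditive.sub_comp, Category.assoc]
          have : inj (n.down + 1) ≫ cpr hc ⟨0⟩ = 0 := inj_cpr_ne hc (by simp)
          rw [this, comp_zero, sub_zero]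
        rw [← e, ← Category.assoc, hf, zero_comp]
      | succ n ih =>
        have e : sh ≫ cpr hc ⟨n+1⟩ = cpr hc ⟨n+1⟩ - cpr hc ⟨n⟩ ≫ ψ n := by
          refine Cofan.IsColimit.hom_ext hc _ _ fun m => ?_
          obtain ⟨m⟩ := m
          change inj m ≫ sh ≫ _ = inj m ≫ _
          rw [← Category.assoc, hsh, Preadditive.sub_comp, Preadditive.comp_sub, Category.assoc]
          congr 1
          by_cases hm : m = n
          · subst hm
            have h1 : inj (m + 1) ≫ cpr hc ⟨m+1⟩ = 𝟙 _ := inj_cpr hc _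
            have h2 : inj m ≫ cpr hc ⟨m⟩ = 𝟙 _ := inj_cpr hc _
            rw [h1, ← Category.assoc, h2, Category.comp_id, Category.id_comp]
          · have h1 : inj (m + 1) ≫ cpr hc ⟨n+1⟩ = 0 := inj_cpr_ne hc (by simpa using hm)
            have h2 : inj m ≫ cpr hc ⟨n⟩ = 0 := inj_cpr_ne hc (by simpa using hm)
            rw [h1, ← Category.assoc, h2, comp_zero, zero_comp]
        have e2 := congrArg (f ≫ ·) e
        simp only [← Category.assoc, hf, zero_comp, Preadditive.comp_sub] at e2
        rw [ih, zero_comp, sub_zero] at e2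
        exact e2.symm
    rw [hft]
    refine Finset.sum_eq_zero fun i hi => ?_
    rw [← sum_cpr hc t h i hi, ← hft, key i.down, zero_comp]
  -- every map from a compact factors through one stage
  have stage : ∀ s : DD A, IsCpt s → ∀ f : s ⟶ W, ∃ n, ∃ h : s ⟶ (sq n).W, f = h ≫ inj n ≫ π := by
    intro s hs f
    have hfδ : f ≫ δ = 0 := by
      obtain ⟨k, hk⟩ := (shiftFunctor (DD A) (1 : ℤ)).map_surjective
        ((shiftFunctorCompIsoId (DD A) (-1 : ℤ) 1 (by simp)).hom.app s ≫ f ≫ δ)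
      have hk0 : k = 0 := by
        refine shinj _ (isCpt_shift hs (-1)) _ ?_
        refine (shiftFunctor (DD A) (1 : ℤ)).map_injective ?_
        have z31 : δ ≫ sh⟦(1 : ℤ)⟧' = 0 := comp_distTriang_mor_zero₃₁ _ hT
        rw [Functor.map_comp, hk, Functor.map_zero, Category.assoc, Category.assoc, z31,
          comp_zero, comp_zero]
      rw [hk0, Functor.map_zero] at hk
      rw [← cancel_epi ((shiftFunctorCompIsoId (DD A) (-1 : ℤ) 1 (by simp)).hom.app s), ← hk, comp_zero]
    obtain ⟨f', hf'⟩ : ∃ f' : s ⟶ c.pt, f = f' ≫ π := Triangle.coyoneda_exact₃ _ hT f hfδ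
    obtain ⟨t, h, hft⟩ := hs _ _ c hc f'
    have up : ∀ m k (x : s ⟶ (sq m).W), ∃ y : s ⟶ (sq (m + k)).W, x ≫ inj m ≫ π = y ≫ inj (m+k) ≫ π := by
      intro m k x
      induction k with
      | zero => exact ⟨x, rfl⟩
      | succ k ih =>
        obtain ⟨y, hy⟩ := ih
        exact ⟨y ≫ ψ (m+k), by rw [hy, hpi, Category.assoc]; rfl⟩
    have up' : ∀ m N, m ≤ N → ∀ (x : s ⟶ (sq m).W), ∃ y : s ⟶ (sq N).W, x ≫ inj m ≫ π = y ≫ inj N ≫ π := by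
      intro m N hmN x
      obtain ⟨k, rfl⟩ := Nat.exists_eq_add_of_le hmN
      exact up m k x
    let N := t.sup (fun i => i.down)
    have hN : ∀ i ∈ t, i.down ≤ N := fun i hi => Finset.le_sup (f := fun i : ULift.{u} ℕ => i.down) hi
    have hz' : ∀ i, ∃ k : s ⟶ (sq N).W, i ∈ t → h i ≫ c.inj i ≫ π = k ≫ inj N ≫ π := by
      intro i
      by_cases hi : i ∈ t
      · obtain ⟨k, hk⟩ := up' i.down N (hN i hi) (h i); exact ⟨k, fun _ => hk⟩
      · exact ⟨0, fun h => (hi h).elim⟩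
    choose y hy using hz'
    refine ⟨N, ∑ i ∈ t, y i, ?_⟩
    rw [hf', hft, Preadditive.sum_comp, Preadditive.sum_comp]
    refine Finset.sum_congr rfl fun i hi => ?_
    rw [Category.assoc, hy i hi]
  obtain ⟨V, g, e, hT'⟩ := distinguished_cocone_triangle p
  refine ⟨W, V, p, g, e, hT', ?_, cone_orth S hS _ hT' ?_ ?_⟩
  · intro 𝒟 h𝒟 hSD
    have hcpt := h𝒟.2.2.2.2.2 _ _ c hc fun k => (sq k.down).mem 𝒟 h𝒟 hSD
    exact h𝒟.2.2.2.1 _ hT hcpt hcpt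
  · intro i k
    obtain ⟨h, hh⟩ := hs0 i k
    refine ⟨h ≫ inj 0 ≫ π, ?_⟩
    change (h ≫ inj 0 ≫ π) ≫ p = k
    rw [Category.assoc, Category.assoc, ← hp, hq]
    exact hh
  · intro i k hk
    obtain ⟨n, h, rfl⟩ := stage _ (hcpt i) k
    change (h ≫ inj n ≫ π) ≫ p = 0 at hk
    rw [Category.assoc, Category.assoc, ← hp, hq] at hk
    have := hψ0 n i h hk
    change h ≫ inj n ≫ π = 0
    rw [hpi, reassoc_of% this, zero_comp]

end bous
end Tele

namespace Tele
section tthree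
variable {A : Type u} [Ring A] [HasDerivedCategory.{w} (ModuleCat.{u} A)]

noncomputable def H0shift (X : DD A) (n : ℤ) :
    H0.obj (X⟦n⟧) ≅ (DerivedCategory.homologyFunctor (ModuleCat.{u} A) n).obj X :=
  ((DerivedCategory.homologyFunctor (ModuleCat.{u} A) 0).shiftIso n 0 n (by simp)).app X

open ZeroObject in
theorem isZero_of_H (X : DD A) (h : ∀ n : ℤ, IsZero (H0.obj (X⟦n⟧))) : IsZero X := by
  have : IsIso (0 : X ⟶ 0) := by
    rw [DerivedCategory.isIso_iff]
    intro n
    have h1 : IsZero ((DerivedCategory.homologyFunctor (ModuleCat.{u} A) n).obj X) :=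
      (h n).of_iso (H0shift X n).symm
    have h2 : IsZero ((DerivedCategory.homologyFunctor (ModuleCat.{u} A) n).obj (0 : DD A)) :=
      Functor.map_isZero _ (isZero_zero _)
    exact ⟨0, h1.eq_of_src _ _, h2.eq_of_src _ _⟩
  exact (isZero_zero _).of_iso (asIso (0 : X ⟶ 0))

theorem isZero_mod (M : ModuleCat.{u} A) (h : ∀ f : ModuleCat.of A A ⟶ M, f = 0) : IsZero M := by
  rw [ModuleCat.isZero_iff_subsingleton] 
  refine subsingleton_of_forall_eq 0 fun x => ?_
  have := congr_arg (fun f => f.hom (1 : A)) (h (ModuleCat.ofHom (LinearMap.toSpanSingleton A M x)))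
  simpa using this

noncomputable def shEq (s Y : DD A) (n : ℤ) : (s⟦n⟧ ⟶ Y) ≃ (s ⟶ Y⟦-n⟧) :=
  (shiftEquiv (DD A) n).toAdjunction.homEquiv s Y

theorem shEq_nat {s s' Y : DD A} {n : ℤ} (f : s' ⟶ s) (g : s ⟶ Y⟦-n⟧) :
    (shEq s' Y n).symm (f ≫ g) = f⟦n⟧' ≫ (shEq s Y n).symm g :=
  (shiftEquiv (DD A) n).toAdjunction.homEquiv_naturality_left_symm f g

theorem shEq_natr {s Y Y' : DD A} {n : ℤ} (f : s⟦n⟧ ⟶ Y) (g : Y ⟶ Y') :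
    shEq s Y' n (f ≫ g) = shEq s Y n f ≫ g⟦-n⟧' :=
  (shiftEquiv (DD A) n).toAdjunction.homEquiv_naturality_right f g

theorem shEq_zero {s Y : DD A} {n : ℤ} : shEq s Y n 0 = 0 := by
  have := shEq_natr (s := s) (n := n) (0 : s⟦n⟧ ⟶ Y) (0 : Y ⟶ Y)
  rw [zero_comp, Functor.map_zero, comp_zero] at this
  exact this

theorem shEq_symm_zero {s Y : DD A} {n : ℤ} : (shEq s Y n).symm 0 = 0 := by
  rw [Equiv.symm_apply_eq, shEq_zero]

instance projA : Projective (ModuleCat.of A A) :=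
  ModuleCat.projective_of_free (ι := Unit) (Module.Basis.singleton Unit A)

noncomputable abbrev genA (m : ULift.{u} ℤ) : DD A := (sg.obj (ModuleCat.of A A))⟦m.down⟧

theorem genA_shift : ShiftClosed (genA (A := A)) := fun i n =>
  ⟨⟨i.down + n⟩, ⟨(shiftFunctorAdd (DD A) i.down n).app _⟩⟩

theorem genA_detect (Y : DD A) (h : ∀ i (f : genA i ⟶ Y), f = 0) : IsZero Y := by
  refine isZero_of_H Y fun n => isZero_mod _ fun f => ?_
  obtain ⟨φ, rfl⟩ := hmap_surj _ _ f
  have h1 := h ⟨-n⟩ ((shEq _ _ (-n)).symm (φ ≫ eqToHom (by simp)))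
  have h2 := congrArg (shEq _ _ (-n)) h1
  rw [Equiv.apply_symm_apply, shEq_zero] at h2
  have : φ = 0 := by
    rw [← cancel_mono (eqToHom (by simp) : Y⟦n⟧ ⟶ Y⟦- -n⟧), h2, zero_comp]
  rw [this, hmap_zero]

theorem H0_sg_shift (M : ModuleCat.{u} A) (n : ℤ) (hn : n ≠ 0) : IsZero (H0.obj ((sg.obj M)⟦n⟧)) := by
  refine IsZero.of_iso ?_ (H0shift _ n)
  rcases lt_or_gt_of_ne hn with h | h
  · exact DerivedCategory.isZero_of_isGE _ 0 n h
  · exact DerivedCategory.isZero_of_isLE _ 0 n h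

theorem sg_vanish (P M : ModuleCat.{u} A) [Projective P] (m j : ℤ) (h : m ≠ j)
    (f : (sg.obj P)⟦m⟧ ⟶ (sg.obj M)⟦j⟧) : f = 0 := by
  refine (shEq _ _ m).injective ?_
  rw [shEq_zero]
  refine hmap_inj _ _ _ ?_
  refine IsZero.eq_of_tgt ?_ _ _
  refine IsZero.of_iso (H0_sg_shift M (j + -m) (by omega)) (H0.mapIso ?_)
  exact ((shiftFunctorAdd (DD A) j (-m)).app _).symm


theorem exists_res (hA : IsHereditaryRing A) (M : ModuleCat.{u} A) : ∃ (S : ShortComplex (ModuleCat.{u} A)), S.ShortExact ∧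
    Projective S.X₁ ∧ Projective S.X₂ ∧ S.X₃ = M := by
  let p : (M →₀ A) →ₗ[A] M := Finsupp.linearCombination A id
  have hp : Function.Surjective p := Finsupp.linearCombination_id_surjective A M
  have : Module.Projective A (LinearMap.ker p) := hA (M →₀ A) inferInstance _
  refine ⟨ShortComplex.mk (ModuleCat.ofHom (X := ↥(LinearMap.ker p)) (Y := (M →₀ A)) (LinearMap.ker p).subtype) (ModuleCat.ofHom p) ?_, ?_, ?_, ?_, rfl⟩
  · ext x; exact x.2
  · refine @ShortComplex.ShortExact.mk _ _ _ _ ?_ ?_ ?_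
    · rw [ShortComplex.moduleCat_exact_iff]
      exact fun x hx => ⟨⟨x, hx⟩, rfl⟩
    · exact (ModuleCat.mono_iff_injective _).2 Subtype.val_injective
    · exact (ModuleCat.epi_iff_surjective _).2 hp
  · exact (IsProjective.iff_projective _).1 this
  · exact (IsProjective.iff_projective _).1 (inferInstanceAs (Module.Projective A (M →₀ A)))

theorem exists_lift (hA : IsHereditaryRing A) (M : ModuleCat.{u} A) (X : DD A) (g : M ⟶ H0.obj X) : ∃ α : sg.obj M ⟶ X, hmap α = g := by
  obtain ⟨S, hS, h1, h2, rfl⟩ := exists_res hA M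
  obtain ⟨φ, hφ⟩ := hmap_surj S.X₂ X (S.g ≫ g)
  have h0 : sg.map S.f ≫ φ = 0 := by
    refine hmap_inj _ _ _ ?_
    rw [hmap_pre, hφ, ← Category.assoc, S.zero, zero_comp]
  obtain ⟨α, hα⟩ : ∃ α : sg.obj S.X₃ ⟶ X, φ = sg.map S.g ≫ α :=
    Triangle.yoneda_exact₂ _ hS.singleTriangle_distinguished φ h0
  refine ⟨α, ?_⟩
  have := hS.epi_g
  rw [← cancel_epi S.g, ← hmap_pre, ← hα, hφ]

/-- every object is the coproduct of its shifted homologies -/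
theorem decomp (hA : IsHereditaryRing A) (X : DD A) : ∃ β : ∀ m : ULift.{u} ℤ, (sg.obj (H0.obj (X⟦-m.down⟧)))⟦m.down⟧ ⟶ X,
    Nonempty (IsColimit (Cofan.mk X β)) := by
  choose α hα using fun m : ULift.{u} ℤ => exists_lift hA _ (X⟦-m.down⟧) (𝟙 _)
  let β : ∀ m : ULift.{u} ℤ, (sg.obj (H0.obj (X⟦-m.down⟧)))⟦m.down⟧ ⟶ X := fun m => (shEq _ _ m.down).symm (α m)
  refine ⟨β, ?_⟩
  obtain ⟨c, ⟨hc⟩⟩ := exists_coprod fun m : ULift.{u} ℤ => (sg.obj (H0.obj (X⟦-m.down⟧)))⟦m.down⟧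
  let b : c.pt ⟶ X := Cofan.IsColimit.desc hc β
  have hb : ∀ m, c.inj m ≫ b = β m := fun m => Cofan.IsColimit.fac hc _ m
  have hiso : IsIso b := by
    refine isIso_of_detect genA genA_shift genA_detect b ?_ ?_
    · intro m g
      let x := hmap (shEq _ _ m.down g)
      have hx : sg.map x ≫ α m = shEq _ _ m.down g := by
        rw [← sub_eq_zero]
        refine hmap_inj _ _ _ ?_
        rw [hmap_sub, hmap_pre, hα, Category.comp_id, sub_self]
      refine ⟨(sg.map x)⟦m.down⟧' ≫ c.inj m, ?_⟩
      rw [Category.assoc, hb]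
      refine (shEq_nat _ _).symm.trans ?_
      rw [hx, Equiv.symm_apply_apply]
    · intro m h h0
      obtain ⟨t, k, hk⟩ := isCpt_shift (isCpt_sg (ModuleCat.of A A) (Module.Finite.self A)) m.down _ _ c hc h
      have hk0 : ∀ j, j ≠ m → k j = 0 := fun j hj => sg_vanish _ _ _ _ (fun h => hj (by ext; exact h.symm)) _
      by_cases hm : m ∈ t
      · rw [Finset.sum_eq_single m (fun j _ hj => by rw [hk0 j hj, zero_comp]) (fun h => (h hm).elim)] at hk
        obtain ⟨k', hk'⟩ := (shiftFunctor (DD A) m.down).map_surjective (k m)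
        have h3 : k' ≫ α m = 0 := by
          refine (shEq _ _ m.down).symm.injective ?_
          rw [shEq_nat, shEq_symm_zero]
          change _ ≫ β m = 0
          rw [hk', ← hb, ← Category.assoc, ← hk]
          exact h0
        have h4 : k' = 0 := by
          refine hmap_inj _ _ _ ?_
          have e0 := isIso_rho (H0.obj (X⟦-m.down⟧))
          have e1 : rho _ ≫ H0.map (α m) = 𝟙 _ := hα m
          have e3 : IsIso (rho (H0.obj (X⟦-m.down⟧)) ≫ H0.map (α m)) := by rw [e1]; infer_instance
          have e4 : IsIso (H0.map (α m)) := IsIso.of_isIso_comp_left (rho _) (H0.map (α m))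
          have e2 := hmap_comp k' (α m)
          rw [h3, hmap_zero] at e2
          rw [← cancel_mono (H0.map (α m)), ← e2, zero_comp]
        rw [hk, ← hk', h4, Functor.map_zero, zero_comp]
      · rw [hk]
        refine Finset.sum_eq_zero fun j hj => ?_
        rw [hk0 j (fun h => hm (h ▸ hj)), zero_comp]
  refine ⟨hc.ofIsoColimit (Cofan.ext (asIso b) (fun m => ?_))⟩
  exact hb m

end tthree
end Tele

namespace Tele
section locs
variable {A : Type u} [Ring A] [HasDerivedCategory.{w} (ModuleCat.{u} A)] {𝒟 : Set (DD A)}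

theorem loc_iso (h𝒟 : IsLocalizingSubcategory 𝒟) {X Y : DD A} (e : X ≅ Y) (h : X ∈ 𝒟) : Y ∈ 𝒟 := h𝒟.2.1 X Y h e

theorem loc_shift (h𝒟 : IsLocalizingSubcategory 𝒟) {X : DD A} (n : ℤ) (h : X ∈ 𝒟) : X⟦n⟧ ∈ 𝒟 := h𝒟.2.2.1 X n h

theorem loc_shift_iff (h𝒟 : IsLocalizingSubcategory 𝒟) {X : DD A} (n : ℤ) : X⟦n⟧ ∈ 𝒟 ↔ X ∈ 𝒟 :=
  ⟨fun h => loc_iso h𝒟 ((shiftFunctorCompIsoId (DD A) n (-n) (by simp)).app X) (loc_shift h𝒟 (-n) h),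
    loc_shift h𝒟 n⟩

theorem loc_three (h𝒟 : IsLocalizingSubcategory 𝒟) (T : Triangle (DD A)) (hT : T ∈ distTriang (DD A)) (h₁ : T.obj₁ ∈ 𝒟) (h₂ : T.obj₂ ∈ 𝒟) :
    T.obj₃ ∈ 𝒟 := h𝒟.2.2.2.1 T hT h₁ h₂

theorem loc_one (h𝒟 : IsLocalizingSubcategory 𝒟) (T : Triangle (DD A)) (hT : T ∈ distTriang (DD A)) (h₂ : T.obj₂ ∈ 𝒟) (h₃ : T.obj₃ ∈ 𝒟) :
    T.obj₁ ∈ 𝒟 :=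
  (loc_shift_iff h𝒟 1).1 (loc_three h𝒟 _ (rot_of_distTriang _ hT) h₂ h₃)

theorem loc_two (h𝒟 : IsLocalizingSubcategory 𝒟) (T : Triangle (DD A)) (hT : T ∈ distTriang (DD A)) (h₁ : T.obj₁ ∈ 𝒟) (h₃ : T.obj₃ ∈ 𝒟) :
    T.obj₂ ∈ 𝒟 :=
  loc_one h𝒟 _ (rot_of_distTriang _ hT) h₃ (loc_shift h𝒟 1 h₁)

theorem loc_retract (h𝒟 : IsLocalizingSubcategory 𝒟) {R X : DD A} (i : R ⟶ X) (r : X ⟶ R) (h : i ≫ r = 𝟙 _) (hX : X ∈ 𝒟) : R ∈ 𝒟 := by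
  obtain ⟨Z, g, δ, hT⟩ := distinguished_cocone_triangle i
  have h0 : δ = 0 := by
    have h1 : δ ≫ i⟦(1 : ℤ)⟧' = 0 := comp_distTriang_mor_zero₃₁ _ hT
    have h2 := congrArg (· ≫ r⟦(1 : ℤ)⟧') h1
    simp only [Category.assoc, ← Functor.map_comp, h, zero_comp, CategoryTheory.Functor.map_id, Category.comp_id] at h2
    exact h2
  obtain ⟨e, -, -⟩ := exists_iso_binaryBiproduct_of_distTriang _ hT h0
  exact h𝒟.2.2.2.2.1 R Z (loc_iso h𝒟 e hX)

theorem loc_coprod (h𝒟 : IsLocalizingSubcategory 𝒟) {ι : Type u} {g : ι → DD A} {c : Cofan g} (hc : IsColimit c) (h : ∀ i, g i ∈ 𝒟) : c.pt ∈ 𝒟 :=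
  h𝒟.2.2.2.2.2 _ _ c hc h

theorem loc_of_H (h𝒟 : IsLocalizingSubcategory 𝒟) (hA : IsHereditaryRing A) {X : DD A} (h : ∀ n : ℤ, sg.obj (H0.obj (X⟦n⟧)) ∈ 𝒟) : X ∈ 𝒟 := by
  obtain ⟨β, ⟨hβ⟩⟩ := decomp hA X
  exact loc_coprod h𝒟 hβ fun m => loc_shift h𝒟 _ (h _)

theorem sg_H_mem (h𝒟 : IsLocalizingSubcategory 𝒟) (hA : IsHereditaryRing A) {X : DD A} (hX : X ∈ 𝒟) (n : ℤ) : sg.obj (H0.obj (X⟦n⟧)) ∈ 𝒟 := by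
  obtain ⟨β, ⟨hβ⟩⟩ := decomp hA X
  have h1 := loc_retract h𝒟 _ _ (inj_cpr hβ ⟨-n⟩) hX
  have h2 := (loc_shift_iff h𝒟 _).1 h1
  have e : X⟦- -n⟧ ≅ X⟦n⟧ := eqToIso (by simp)
  exact loc_iso h𝒟 (sg.mapIso (H0.mapIso e)) h2

theorem sg_H0_mem (h𝒟 : IsLocalizingSubcategory 𝒟) (hA : IsHereditaryRing A) {X : DD A} (hX : X ∈ 𝒟) : sg.obj (H0.obj X) ∈ 𝒟 :=
  loc_iso h𝒟 (sg.mapIso (H0.mapIso ((shiftFunctorZero (DD A) ℤ).app X))) (sg_H_mem h𝒟 hA hX 0)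

theorem goodClass (h𝒟 : IsLocalizingSubcategory 𝒟) (hA : IsHereditaryRing A)
    (hpi : ∀ (ι : Type u) (g : ι → DD A) (c : Fan g), IsLimit c → (∀ i, g i ∈ 𝒟) → c.pt ∈ 𝒟) :
    GoodClass (fun Y : ModuleCat.{u} A => sg.obj Y ∈ 𝒟) where
  pi ι Y hY := hpi ι _ _ (isLimitFanMkObjOfIsLimit sg _ _ (ModuleCat.productConeIsLimit Y)) hY
  dsum ι Y hY := by
    classical
    have hc : IsColimit (Cofan.mk (ModuleCat.of A (Π₀ i, Y i)) (fun i => ModuleCat.ofHom (DFinsupp.lsingle (R := A) i))) := by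
      have hl : ∀ (s : Cofan Y) i (x : Y i), DFinsupp.lsum ℕ (fun i => (s.inj i).hom) (DFinsupp.single i x) = (s.inj i).hom x :=
        fun s i x => by simp
      refine Cofan.IsColimit.mk _ (fun s => ModuleCat.ofHom (DFinsupp.lsum ℕ (fun i => (s.inj i).hom))) ?_ ?_
      · intro s i
        ext x
        exact hl s i x
      · intro s m hm
        refine ModuleCat.hom_ext (DFinsupp.lhom_ext fun i x => ?_)
        refine (congr_arg (fun f => f.hom x) (hm i)).trans ?_
        exact (hl s i x).symm
    exact loc_coprod h𝒟 (isColimitCofanMkObjOfIsColimit sg _ _ hc) hY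
  coker M N f hM hN := by
    obtain ⟨Z, g, δ, hT⟩ := distinguished_cocone_triangle (sg.map (ModuleCat.ofHom f))
    have hZ : Z ∈ 𝒟 := loc_three h𝒟 _ hT hM hN
    have hrN := isIso_rho N
    have hrM := isIso_rho M
    have hex := DerivedCategory.HomologySequence.exact₂ _ hT 0
    have hepi : Epi (H0.map g) := by
      refine (DerivedCategory.HomologySequence.epi_homologyMap_mor₂_iff _ hT 0 1).2 ?_
      exact IsZero.eq_of_tgt (DerivedCategory.isZero_of_isLE (sg.obj M) 0 1 (by simp)) _ _
    let p : N →ₗ[A] H0.obj Z := (hmap g).hom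
    have hp : Function.Surjective p := by
      rw [← ModuleCat.epi_iff_surjective]
      exact epi_comp _ _
    have hk : LinearMap.ker p = LinearMap.range f := by
      ext x
      constructor
      · intro hx
        rw [ShortComplex.moduleCat_exact_iff] at hex
        obtain ⟨y, hy⟩ := hex ((rho N).hom x) hx
        have hsur : Function.Surjective (rho M) := (ModuleCat.epi_iff_surjective (rho M)).1 inferInstance
        have hinj : Function.Injective (rho N) := (ModuleCat.mono_iff_injective (rho N)).1 inferInstance
        obtain ⟨y, rfl⟩ := hsur y
        refine ⟨y, hinj ?_⟩
        exact (congr_arg (fun k => k.hom y) (rho_nat (ModuleCat.ofHom f))).symm.trans hy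
      · rintro ⟨y, rfl⟩
        have h1 := hmap_pre (ModuleCat.ofHom f) g
        have h2 : sg.map (ModuleCat.ofHom f) ≫ g = 0 := comp_distTriang_mor_zero₁₂ _ hT
        rw [h2, hmap_zero] at h1
        exact (congr_arg (fun k => k.hom y) h1).symm
    have e : (N ⧸ LinearMap.range f) ≃ₗ[A] H0.obj Z :=
      (Submodule.quotEquivOfEq _ _ hk.symm).trans (p.quotKerEquivOfSurjective hp)
    exact loc_iso h𝒟 (sg.mapIso e.symm.toModuleIso) (sg_H0_mem h𝒟 hA hZ)
  ext M N P f g hf hg hfg hM hP := by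
    have hS : (ShortComplex.mk (ModuleCat.ofHom f) (ModuleCat.ofHom g) (by ext x; exact (hfg _).2 ⟨x, rfl⟩)).ShortExact := by
      refine @ShortComplex.ShortExact.mk _ _ _ _ ?_ ?_ ?_
      · rw [ShortComplex.moduleCat_exact_iff]
        exact fun x hx => (hfg x).1 hx
      · exact (ModuleCat.mono_iff_injective _).2 hf
      · exact (ModuleCat.epi_iff_surjective _).2 hg
    exact loc_two h𝒟 _ hS.singleTriangle_distinguished hM hP

end locs
end Tele

namespace Tele
section pres
variable {A : Type u} [Ring A] [HasDerivedCategory.{w} (ModuleCat.{u} A)]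

theorem sub_tri {Q : Type u} [AddCommGroup Q] [Module A Q] (K : Submodule A Q) :
    ∃ δ : (sg.obj (ModuleCat.of A (Q ⧸ K)) : DD A) ⟶ (sg.obj (ModuleCat.of A K))⟦(1 : ℤ)⟧,
      Triangle.mk (sg.map (ModuleCat.ofHom (X := K) (Y := Q) K.subtype)) (sg.map (ModuleCat.ofHom K.mkQ)) δ ∈ distTriang (DD A) := by
  have hS : (ShortComplex.mk (ModuleCat.ofHom (X := K) (Y := Q) K.subtype) (ModuleCat.ofHom K.mkQ)
      (by ext x; exact (Submodule.Quotient.mk_eq_zero K).2 x.2)).ShortExact := by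
    refine @ShortComplex.ShortExact.mk _ _ _ _ ?_ ?_ ?_
    · rw [ShortComplex.moduleCat_exact_iff]
      exact fun x hx => ⟨⟨x, (Submodule.Quotient.mk_eq_zero K).1 hx⟩, rfl⟩
    · exact (ModuleCat.mono_iff_injective _).2 (Subtype.val_injective)
    · exact (ModuleCat.epi_iff_surjective _).2 (Submodule.mkQ_surjective K)
  exact ⟨_, hS.singleTriangle_distinguished⟩

def LOrth (𝒟 : Set (DD A)) (X : DD A) : Prop := ∀ D ∈ 𝒟, ∀ f : X ⟶ D, f = 0

theorem LOrth.iso {𝒟 : Set (DD A)} {X Y : DD A} (h : LOrth 𝒟 X) (e : X ≅ Y) : LOrth 𝒟 Y := by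
  intro D hD f
  have := h D hD (e.hom ≫ f)
  rwa [Preadditive.IsIso.comp_left_eq_zero] at this

theorem lorth_iff {𝒟 : Set (DD A)} (h𝒟 : IsLocalizingSubcategory 𝒟) (X : DD A) :
    LOrth 𝒟 X ↔ ∀ D ∈ 𝒟, ∀ (n : ℤ) (f : X ⟶ D⟦n⟧), f = 0 := by
  constructor
  · intro h D hD n f
    exact h _ (loc_shift h𝒟 n hD) f
  · intro h D hD f
    have := h D hD 0 (f ≫ ((shiftFunctorZero (DD A) ℤ).inv.app D))
    rwa [Preadditive.IsIso.comp_right_eq_zero] at this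

variable {𝒟 : Set (DD A)}

theorem LOrth.shift (h𝒟 : IsLocalizingSubcategory 𝒟) {X : DD A} (h : LOrth 𝒟 X) (n : ℤ) : LOrth 𝒟 (X⟦n⟧) := by
  intro D hD f
  have := h _ (loc_shift h𝒟 (-n) hD) (shEq _ _ _ f)
  rw [← (shEq X D n).symm_apply_apply f, this, shEq_symm_zero]

theorem lorth_h (h𝒟 : IsLocalizingSubcategory 𝒟) {Q : Type u} [AddCommGroup Q] [Module A Q] (K : Submodule A Q)
    (h : LOrth 𝒟 (sg.obj (ModuleCat.of A (Q ⧸ K)))) (Y : ModuleCat.{u} A) (hY : sg.obj Y ∈ 𝒟) (f : Q →ₗ[A] Y)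
    (hf : ∀ k ∈ K, f k = 0) : f = 0 := by
  have h1 := h _ hY (sg.map (ModuleCat.ofHom (K.liftQ f hf)))
  have h2 : ModuleCat.ofHom (K.liftQ f hf) = 0 := by
    apply sg.map_injective
    rw [h1, sg.map_zero]
  ext x
  exact congr_arg (fun g => g.hom (K.mkQ x)) h2

theorem lorth_h' (h𝒟 : IsLocalizingSubcategory 𝒟) {Q : Type u} [AddCommGroup Q] [Module A Q] (K : Submodule A Q)
    (h : LOrth 𝒟 (sg.obj (ModuleCat.of A (Q ⧸ K)))) (Y : ModuleCat.{u} A) (hY : sg.obj Y ∈ 𝒟) (f : K →ₗ[A] Y) :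
    ∃ g : Q →ₗ[A] Y, ∀ k : K, g k = f k := by
  obtain ⟨δ, hT⟩ := sub_tri (A := A) K
  have h1 := (LOrth.shift h𝒟 h (-1)) _ hY ((Triangle.mk (sg.map (ModuleCat.ofHom (X := K) (Y := Q) K.subtype)) (sg.map (ModuleCat.ofHom K.mkQ)) δ).invRotate.mor₁ ≫ (sg.map (ModuleCat.ofHom (X := K) f)))
  obtain ⟨g, hg⟩ : ∃ g : sg.obj (ModuleCat.of A Q) ⟶ sg.obj Y, sg.map (ModuleCat.ofHom (X := K) f) = sg.map (ModuleCat.ofHom (X := K) (Y := Q) K.subtype) ≫ g :=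
    Triangle.yoneda_exact₂ _ (inv_rot_of_distTriang _ hT) _ h1
  obtain ⟨g, rfl⟩ := sg.map_surjective g
  rw [← sg.map_comp] at hg
  have h2 := sg.map_injective hg
  exact ⟨g.hom, fun k => (congr_arg (fun g => g.hom k) h2).symm⟩

theorem lorth_of (h𝒟 : IsLocalizingSubcategory 𝒟) (hA : IsHereditaryRing A) {Q : Type u} [AddCommGroup Q] [Module A Q] (K : Submodule A Q)
    (hQ : Module.Projective A Q)
    (h : ∀ Y : ModuleCat.{u} A, sg.obj Y ∈ 𝒟 → ∀ f : Q →ₗ[A] Y, (∀ k ∈ K, f k = 0) → f = 0)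
    (h' : ∀ Y : ModuleCat.{u} A, sg.obj Y ∈ 𝒟 → ∀ f : K →ₗ[A] Y, ∃ g : Q →ₗ[A] Y, ∀ k : K, g k = f k) :
    LOrth 𝒟 (sg.obj (ModuleCat.of A (Q ⧸ K))) := by
  have hK := hA Q hQ K
  have : Projective (ModuleCat.of A Q) := (IsProjective.iff_projective (P := Q)).1 hQ
  have : Projective (ModuleCat.of A K) := (IsProjective.iff_projective (P := K)).1 hK
  intro D hD f
  obtain ⟨δ, hT⟩ := sub_tri (A := A) K
  have hz : sg.map (ModuleCat.ofHom (X := K) (Y := Q) K.subtype) ≫ sg.map (ModuleCat.ofHom K.mkQ) = 0 :=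
    comp_distTriang_mor_zero₁₂ _ hT
  have hz' : sg.map (ModuleCat.ofHom K.mkQ) ≫ δ = 0 :=
    comp_distTriang_mor_zero₂₃ _ hT
  have hz'' : δ ≫ (sg.map (ModuleCat.ofHom (X := K) (Y := Q) K.subtype))⟦(1 : ℤ)⟧' = 0 :=
    comp_distTriang_mor_zero₃₁ _ hT
  have h1 : sg.map (ModuleCat.ofHom K.mkQ) ≫ f = 0 := by
    apply hmap_inj (ModuleCat.of A Q)
    have h2 : sg.map (ModuleCat.ofHom (X := K) (Y := Q) K.subtype) ≫ sg.map (ModuleCat.ofHom K.mkQ) ≫ f = 0 := by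
      rw [← Category.assoc, hz, zero_comp]
    have h3 := hmap_pre (ModuleCat.ofHom (X := K) (Y := Q) K.subtype) (sg.map (ModuleCat.ofHom K.mkQ) ≫ f)
    rw [h2, hmap_zero] at h3
    refine ModuleCat.hom_ext (h _ (sg_H0_mem h𝒟 hA hD) _ fun k hk => ?_)
    exact (congr_arg (fun g => g.hom (⟨k, hk⟩ : K)) h3).symm
  obtain ⟨g, hg⟩ : ∃ g : (sg.obj (ModuleCat.of A K))⟦(1 : ℤ)⟧ ⟶ D, f = δ ≫ g := Triangle.yoneda_exact₃ _ hT f h1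
  obtain ⟨g', hg'⟩ : ∃ g', (shEq _ D 1).symm g' = g := ⟨_, (shEq _ D 1).symm_apply_apply g⟩
  obtain ⟨k, hk⟩ := h' _ (sg_H0_mem h𝒟 hA (loc_shift h𝒟 (-1) hD)) (hmap g').hom
  obtain ⟨φ, hφ⟩ := hmap_surj (ModuleCat.of A Q) (D⟦(-1 : ℤ)⟧) (ModuleCat.ofHom k)
  have h4 : sg.map (ModuleCat.ofHom (X := K) (Y := Q) K.subtype) ≫ φ = g' := by
    have h5 : hmap (sg.map (ModuleCat.ofHom (X := K) (Y := Q) K.subtype) ≫ φ - g') = 0 := by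
      rw [hmap_sub, hmap_pre, hφ, sub_eq_zero]
      ext x
      exact hk x
    exact sub_eq_zero.1 (hmap_inj _ _ _ h5)
  rw [hg, ← hg', ← h4, shEq_nat, ← Category.assoc, hz'', zero_comp]

end pres
end Tele

namespace Tele
section fps
variable {A : Type u} [Ring A] [HasDerivedCategory.{w} (ModuleCat.{u} A)]

theorem exists_fp_aux {𝒟 : Set (DD A)} (h𝒟 : IsLocalizingSubcategory 𝒟) (hA : IsHereditaryRing A)
    (hpi : ∀ (ι : Type u) (g : ι → DD A) (c : Fan g), IsLimit c → (∀ i, g i ∈ 𝒟) → c.pt ∈ 𝒟)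
    (M : ModuleCat.{u} A) (hM : LOrth 𝒟 (sg.obj M)) {Q : Type u} [AddCommGroup Q] [Module A Q]
    (hQ : Module.Projective A Q) (π : Q →ₗ[A] M) (hπ : Function.Surjective π) (q : Q) :
    ∃ (n : ℕ) (U : Submodule A (Fin n → A)), U.FG ∧ LOrth 𝒟 (sg.obj (ModuleCat.of A ((Fin n → A) ⧸ U))) ∧
      ∃ (f : ((Fin n → A) ⧸ U) →ₗ[A] M) (y : _), f y = π q := by
  have h1 : LOrth 𝒟 (sg.obj (ModuleCat.of A (Q ⧸ LinearMap.ker π))) :=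
    hM.iso (sg.mapIso (π.quotKerEquivOfSurjective hπ).symm.toModuleIso)
  obtain ⟨V, U, hV, hU, hUK, hq, hUV, a, b⟩ := theoremM hA (goodClass h𝒟 hA hpi) hQ (LinearMap.ker π)
    (fun Y hY f hf => lorth_h h𝒟 _ h1 Y hY f hf) (fun Y hY f => lorth_h' h𝒟 _ h1 Y hY f) q
  have h2 : LOrth 𝒟 (sg.obj (ModuleCat.of A (V ⧸ U.submoduleOf V))) := by
    refine lorth_of h𝒟 hA _ (hA _ hQ V) ?_ ?_
    · intro Y hY f hf
      exact a Y hY f fun k hk => hf k hk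
    · intro Y hY f
      obtain ⟨g, hg⟩ := b Y hY (f ∘ₗ (Submodule.submoduleOfEquivOfLe hUV).symm.toLinearMap)
      exact ⟨g, fun k => hg k.1 k.2⟩
  have hVp := hA _ hQ V
  have hVf : Module.Finite A V := Module.Finite.iff_fg.2 hV
  have hVfp := Module.finitePresentation_of_projective A V
  have hfp : Module.FinitePresentation A (V ⧸ U.submoduleOf V) := by
    refine Module.finitePresentation_of_surjective (U.submoduleOf V).mkQ (Submodule.mkQ_surjective _) ?_
    rw [Submodule.ker_mkQ]
    have := Module.Finite.iff_fg.2 hU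
    exact Module.Finite.iff_fg.1 (Module.Finite.equiv (Submodule.submoduleOfEquivOfLe hUV).symm)
  obtain ⟨n, K, e, hK⟩ := Module.FinitePresentation.exists_fin A (V ⧸ U.submoduleOf V)
  refine ⟨n, K, hK, h2.iso (sg.mapIso e.toModuleIso), ?_⟩
  refine ⟨((U.submoduleOf V).liftQ (π ∘ₗ V.subtype) fun k hk => hUK hk) ∘ₗ e.symm.toLinearMap, e (Submodule.Quotient.mk ⟨_, hq⟩), ?_⟩
  simp
  rfl

theorem exists_fp {𝒟 : Set (DD A)} (h𝒟 : IsLocalizingSubcategory 𝒟) (hA : IsHereditaryRing A)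
    (hpi : ∀ (ι : Type u) (g : ι → DD A) (c : Fan g), IsLimit c → (∀ i, g i ∈ 𝒟) → c.pt ∈ 𝒟)
    (M : ModuleCat.{u} A) (hM : LOrth 𝒟 (sg.obj M)) (x : M) :
    ∃ (n : ℕ) (U : Submodule A (Fin n → A)), U.FG ∧ LOrth 𝒟 (sg.obj (ModuleCat.of A ((Fin n → A) ⧸ U))) ∧
      ∃ (f : ((Fin n → A) ⧸ U) →ₗ[A] M) (y : _), f y = x := by
  have h := exists_fp_aux h𝒟 hA hpi M hM (Q := M →₀ A) inferInstance (Finsupp.linearCombination A id)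
    (Finsupp.linearCombination_id_surjective A M) (Finsupp.single x 1)
  simpa using h

theorem small_cone (T : Triangle (DD A)) (hT : T ∈ distTriang (DD A)) (X : DD A)
    (h₁ : Small.{u} ((T.obj₁)⟦(1 : ℤ)⟧ ⟶ X)) (h₂ : Small.{u} (T.obj₂ ⟶ X)) : Small.{u} (T.obj₃ ⟶ X) := by
  classical
  let s : (T.obj₂ ⟶ X) → (T.obj₃ ⟶ X) := fun b => if h : ∃ k, T.mor₂ ≫ k = b then h.choose else 0
  have hs : ∀ k, T.mor₂ ≫ s (T.mor₂ ≫ k) = T.mor₂ ≫ k := by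
    intro k
    have h : ∃ k', T.mor₂ ≫ k' = T.mor₂ ≫ k := ⟨k, rfl⟩
    simp only [s, dif_pos h]
    exact h.choose_spec
  refine small_of_surjective (f := fun p : ((T.obj₁)⟦(1 : ℤ)⟧ ⟶ X) × (T.obj₂ ⟶ X) => T.mor₃ ≫ p.1 + s p.2) ?_
  intro k
  obtain ⟨a, ha⟩ : ∃ a : (T.obj₁)⟦(1 : ℤ)⟧ ⟶ X, k - s (T.mor₂ ≫ k) = T.mor₃ ≫ a :=
    Triangle.yoneda_exact₃ _ hT _ (by rw [Preadditive.comp_sub, hs, sub_self])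
  exact ⟨(a, T.mor₂ ≫ k), by simp [← ha]⟩

theorem small_sg (P : ModuleCat.{u} A) [Projective P] (X : DD A) : Small.{u} (sg.obj P ⟶ X) := by
  refine small_of_injective (f := fun φ : sg.obj P ⟶ X => hmap φ) ?_
  intro φ ψ h
  have h' : hmap (φ - ψ) = 0 := by rw [hmap_sub]; exact sub_eq_zero.2 h
  exact sub_eq_zero.1 (hmap_inj P X _ h')

theorem small_shift (s X : DD A) (n : ℤ) (h : Small.{u} (s ⟶ X⟦-n⟧)) : Small.{u} (s⟦n⟧ ⟶ X) :=
  (small_congr (shEq s X n)).2 h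

theorem small_quot (hA : IsHereditaryRing A) {Q : Type u} [AddCommGroup Q] [Module A Q] (hQ : Module.Projective A Q)
    (K : Submodule A Q) (X : DD A) : Small.{u} (sg.obj (ModuleCat.of A (Q ⧸ K)) ⟶ X) := by
  have hK := hA Q hQ K
  have : Projective (ModuleCat.of A Q) := (IsProjective.iff_projective (P := Q)).1 hQ
  have : Projective (ModuleCat.of A K) := (IsProjective.iff_projective (P := K)).1 hK
  obtain ⟨δ, hT⟩ := sub_tri (A := A) K
  exact small_cone _ hT X (small_shift _ _ _ (small_sg _ _)) (small_sg _ _)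

theorem cpt_quot (hA : IsHereditaryRing A) {Q : Type u} [AddCommGroup Q] [Module A Q] (hQ : Module.Projective A Q)
    (hQf : Module.Finite A Q) (K : Submodule A Q) (hKf : K.FG) : IsCpt (sg.obj (ModuleCat.of A (Q ⧸ K)) : DD A) := by
  have hK := hA Q hQ K
  have : Projective (ModuleCat.of A Q) := (IsProjective.iff_projective (P := Q)).1 hQ
  have : Projective (ModuleCat.of A K) := (IsProjective.iff_projective (P := K)).1 hK
  obtain ⟨δ, hT⟩ := sub_tri (A := A) K
  exact isCpt_cone _ hT (isCpt_sg _ (Module.Finite.iff_fg.2 hKf)) (isCpt_sg _ hQf)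

/-- index of the generating family -/
def Idx (𝒞 : Set (DD A)) : Type u :=
  {k : Σ n : ℕ, Submodule A (Fin n → A) // k.2.FG ∧ sg.obj (ModuleCat.of A ((Fin k.1 → A) ⧸ k.2)) ∈ 𝒞} × ULift.{u} ℤ

/-- the generating family -/
noncomputable def Fam (𝒞 : Set (DD A)) (i : Idx 𝒞) : DD A :=
  (sg.obj (ModuleCat.of A ((Fin i.1.1.1 → A) ⧸ i.1.1.2)))⟦i.2.down⟧

theorem fam_shift (𝒞 : Set (DD A)) : ShiftClosed (Fam 𝒞) := by
  intro i n
  exact ⟨⟨i.1, ⟨i.2.down + n⟩⟩, ⟨(shiftFunctorAdd (DD A) i.2.down n).app _⟩⟩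

theorem fam_small (hA : IsHereditaryRing A) (𝒞 : Set (DD A)) (i : Idx 𝒞) (X : DD A) : Small.{u} (Fam 𝒞 i ⟶ X) :=
  small_shift _ _ _ (small_quot hA inferInstance _ _)

theorem fam_cpt (hA : IsHereditaryRing A) (𝒞 : Set (DD A)) (i : Idx 𝒞) : IsCpt (Fam 𝒞 i) :=
  isCpt_shift (cpt_quot hA inferInstance inferInstance _ i.1.2.1) _

theorem fam_mem {𝒞 : Set (DD A)} (h𝒞 : IsLocalizingSubcategory 𝒞) (i : Idx 𝒞) : Fam 𝒞 i ∈ 𝒞 :=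
  loc_shift h𝒞 _ i.1.2.2

theorem three_gen (hA : IsHereditaryRing A) {𝒞 𝒟 : Set (DD A)} (h𝒞 : IsLocalizingSubcategory 𝒞)
    (h𝒟 : IsLocalizingSubcategory 𝒟)
    (hpi : ∀ (ι : Type u) (g : ι → DD A) (c : Fan g), IsLimit c → (∀ i, g i ∈ 𝒟) → c.pt ∈ 𝒟)
    (h : ∀ X, X ∈ 𝒞 ↔ LOrth 𝒟 X) (X : DD A) (hX : X ∈ 𝒞) : InLoc (Fam 𝒞) X := by
  obtain ⟨W, V, f, g, δ, hT, hW, hV⟩ := bousfield (Fam 𝒞) (fam_small hA 𝒞) (fam_shift 𝒞) (fam_cpt hA 𝒞) X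
  have hWC : W ∈ 𝒞 := hW 𝒞 h𝒞 (fam_mem h𝒞)
  have hVC : V ∈ 𝒞 := loc_three h𝒞 _ hT hWC hX
  have hV0 : IsZero V := by
    refine isZero_of_H V fun m => ?_
    have hM := (h _).1 (sg_H_mem h𝒞 hA hVC m)
    rw [ModuleCat.isZero_iff_subsingleton]
    refine subsingleton_of_forall_eq 0 fun x => ?_
    obtain ⟨n, U, hU, hUo, φ, y, rfl⟩ := exists_fp h𝒟 hA hpi _ hM x
    obtain ⟨α, hα⟩ := exists_lift hA (H0.obj (V⟦m⟧)) (V⟦m⟧) (𝟙 _)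
    have h0 : sg.map (ModuleCat.ofHom φ) ≫ α = 0 := by
      have h1 : (sg.map (ModuleCat.ofHom φ) ≫ α)⟦-m⟧' ≫ (shiftFunctorCompIsoId (DD A) m (-m) (by simp)).hom.app V = 0 := hV ⟨⟨⟨n, U⟩, hU, (h _).2 hUo⟩, ⟨-m⟩⟩ ((sg.map (ModuleCat.ofHom φ) ≫ α)⟦-m⟧' ≫ (shiftFunctorCompIsoId (DD A) m (-m) (by simp)).hom.app V)
      rw [Preadditive.IsIso.comp_right_eq_zero] at h1
      apply (shiftFunctor (DD A) (-m)).map_injective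
      rw [h1, Functor.map_zero]
    have h2 := hmap_pre (ModuleCat.ofHom φ) α
    rw [h0, hmap_zero, hα] at h2
    exact (congr_arg (fun k => k.hom y) h2).symm
  have : IsIso f := (Triangle.isZero₃_iff_isIso₁ _ hT).1 hV0
  intro 𝒟' h𝒟' hS
  exact loc_iso h𝒟' (asIso f) (hW 𝒟' h𝒟' hS)
end fps
end Tele

namespace Tele
section perf
variable {A : Type u} [Ring A] [HasDerivedCategory.{w} (ModuleCat.{u} A)]

theorem fin_of_iso {M N : ModuleCat.{u} A} (e : M ≅ N) (h : Module.Finite A M) : Module.Finite A N :=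
  Module.Finite.equiv e.toLinearEquiv

theorem fin_of_isZero {M : ModuleCat.{u} A} (h : IsZero M) : Module.Finite A M := by
  have := ModuleCat.subsingleton_of_isZero h
  infer_instance

theorem single_fp (P : ModuleCat.{u} A) (hP : Projective P) (hPf : Module.Finite A P) (n : ℤ) :
    Projective (((CochainComplex.singleFunctor (ModuleCat.{u} A) 0).obj P).X n) ∧
    Module.Finite A (((CochainComplex.singleFunctor (ModuleCat.{u} A) 0).obj P).X n) := by
  by_cases h : n = 0
  · subst h
    have e : P ≅ ((CochainComplex.singleFunctor (ModuleCat.{u} A) 0).obj P).X 0 :=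
      (HomologicalComplex.singleObjXSelf (ComplexShape.up ℤ) 0 P).symm
    exact ⟨Projective.of_iso e hP, fin_of_iso e hPf⟩
  · have hz : IsZero (((CochainComplex.singleFunctor (ModuleCat.{u} A) 0).obj P).X n) :=
      HomologicalComplex.isZero_single_obj_X _ _ _ _ h
    exact ⟨hz.projective, fin_of_isZero hz⟩

theorem single_zero (P : ModuleCat.{u} A) (n : ℤ) (h : n ≠ 0) : IsZero (((CochainComplex.singleFunctor (ModuleCat.{u} A) 0).obj P).X n) :=
  HomologicalComplex.isZero_single_obj_X _ _ _ _ h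

theorem perf_cone (T : Triangle (DD A)) (hT : T ∈ distTriang (DD A)) {P Q : ModuleCat.{u} A} (f : P ⟶ Q)
    (hP : Projective P) (hPf : Module.Finite A P) (hQ : Projective Q) (hQf : Module.Finite A Q)
    (e₁ : T.obj₁ ≅ sg.obj P) (e₂ : T.obj₂ ≅ sg.obj Q) (h : T.mor₁ ≫ e₂.hom = e₁.hom ≫ sg.map f) :
    IsPerfectComplex T.obj₃ := by
  let f' := (CochainComplex.singleFunctor (ModuleCat.{u} A) 0).map f
  have e := isoTriangleOfIso₁₂ T _ hT (DerivedCategory.mappingCone_triangle_distinguished f') e₁ e₂ h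
  have X : ∀ n, (CochainComplex.mappingCone f').X n ≅
      ((CochainComplex.singleFunctor (ModuleCat.{u} A) 0).obj P).X (n+1) ⊞ ((CochainComplex.singleFunctor (ModuleCat.{u} A) 0).obj Q).X n :=
    fun n => HomologicalComplex.homotopyCofiber.XIsoBiprod f' n (n+1) rfl
  have hz : ∀ n, n ≠ 0 → n + 1 ≠ 0 → IsZero ((CochainComplex.mappingCone f').X n) := by
    intro n h0 h1
    exact IsZero.of_iso ((biprod_isZero_iff _ _).2 ⟨single_zero P _ h1, single_zero Q _ h0⟩) (X n)
  refine ⟨CochainComplex.mappingCone f', -1, 0, ?_, ?_, ?_, ⟨(Triangle.π₃.mapIso e).symm⟩⟩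
  · intro n
    have h1 := single_fp P hP hPf (n+1)
    have h2 := single_fp Q hQ hQf n
    have := h1.1
    have := h2.1
    have := h1.2
    have := h2.2
    refine ⟨Projective.of_iso (X n).symm inferInstance, fin_of_iso ((ModuleCat.biprodIsoProd _ _).symm ≪≫ (X n).symm) ?_⟩
    exact Module.Finite.prod
  · intro n hn
    exact hz n (by omega) (by omega)
  · intro n hn
    exact hz n (by omega) (by omega)

theorem perf_quot (hA : IsHereditaryRing A) {Q : Type u} [AddCommGroup Q] [Module A Q] (hQ : Module.Projective A Q)
    (hQf : Module.Finite A Q) (K : Submodule A Q) (hKf : K.FG) : IsPerfectComplex (sg.obj (ModuleCat.of A (Q ⧸ K)) : DD A) := by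
  have hK := hA Q hQ K
  have h1 : Projective (ModuleCat.of A Q) := (IsProjective.iff_projective (P := Q)).1 hQ
  have h2 : Projective (ModuleCat.of A K) := (IsProjective.iff_projective (P := K)).1 hK
  obtain ⟨δ, hT⟩ := sub_tri (A := A) K
  exact perf_cone _ hT (ModuleCat.ofHom (X := K) (Y := Q) K.subtype) h2 (Module.Finite.iff_fg.2 hKf) h1 hQf (Iso.refl _) (Iso.refl _)
    ((Category.comp_id _).trans (Category.id_comp _).symm)

end perf
end Tele

namespace Tele
section perf2a
variable {A : Type u} [Ring A]

theorem fp_quot_range (hA : IsHereditaryRing A) {X₁ X₂ X₃ : Type u} [AddCommGroup X₁] [Module A X₁] [AddCommGroup X₂] [Module A X₂]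
    [AddCommGroup X₃] [Module A X₃] (g : X₂ →ₗ[A] X₃) (f : X₁ →ₗ[A] LinearMap.ker g) (h₁ : Module.Finite A X₁)
    (h₂ : Module.Finite A X₂) (h₂' : Module.Projective A X₂) (h₃ : Module.Projective A X₃) :
    Module.FinitePresentation A (LinearMap.ker g ⧸ LinearMap.range f) := by
  obtain ⟨p, hp⟩ := exists_retract_ker hA h₃ g
  have hk := hA _ h₂' (LinearMap.ker g)
  have hf : Module.Finite A (LinearMap.ker g) := Module.Finite.of_surjective p (fun x => ⟨x, hp x⟩)
  have := Module.finitePresentation_of_projective A (LinearMap.ker g)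
  refine Module.finitePresentation_of_surjective (LinearMap.range f).mkQ (Submodule.mkQ_surjective _) ?_
  rw [Submodule.ker_mkQ]
  exact Module.Finite.iff_fg.1 inferInstance

end perf2a
section perf2
variable {A : Type u} [Ring A] [HasDerivedCategory.{w} (ModuleCat.{u} A)]

theorem perf_H (hA : IsHereditaryRing A) (X : DD A) (hX : IsPerfectComplex X) (n : ℤ) : Module.FinitePresentation A (H0.obj (X⟦n⟧)) := by
  obtain ⟨K, a, b, hK, -, -, ⟨e⟩⟩ := hX
  have e1 : H0.obj (X⟦n⟧) ≅ K.homology n :=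
    H0shift X n ≪≫ (DerivedCategory.homologyFunctor _ n).mapIso e.symm ≪≫
      (DerivedCategory.homologyFunctorFactors (ModuleCat.{u} A) n).app K
  have e2 := e1 ≪≫ (K.sc n).moduleCatHomologyIso
  have hp : ∀ n, Module.Projective A (K.X n) := fun n => (IsProjective.iff_projective (P := K.X n)).2 (hK n).1
  have := fp_quot_range hA (K.sc n).g.hom (K.sc n).moduleCatToCycles (hK _).2 (hK _).2 (hp _) (hp _)
  exact @Module.FinitePresentation.of_equiv _ _ _ _ _ _ _ _ e2.symm.toLinearEquiv this

theorem two_gen (hA : IsHereditaryRing A) {𝒞 : Set (DD A)} (h𝒞 : IsLocalizingSubcategory 𝒞)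
    (h : ∀ 𝒟 : Set (DD A), IsLocalizingSubcategory 𝒟 → {X | X ∈ 𝒞 ∧ IsPerfectComplex X} ⊆ 𝒟 → 𝒞 ⊆ 𝒟)
    (X : DD A) (hX : X ∈ 𝒞) : InLoc (Fam 𝒞) X := by
  intro 𝒟 h𝒟 hS
  refine h 𝒟 h𝒟 ?_ hX
  rintro Y ⟨hY, hYp⟩
  refine loc_of_H h𝒟 hA fun n => ?_
  have := perf_H hA Y hYp n
  obtain ⟨k, U, e, hU⟩ := Module.FinitePresentation.exists_fin A (H0.obj (Y⟦n⟧))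
  have e' : sg.obj (H0.obj (Y⟦n⟧)) ≅ sg.obj (ModuleCat.of A ((Fin k → A) ⧸ U)) := sg.mapIso (LinearEquiv.toModuleIso e)
  have h1 := loc_iso h𝒞 e' (sg_H_mem h𝒞 hA hY n)
  exact loc_iso h𝒟 e'.symm (loc_iso h𝒟 ((shiftFunctorZero (DD A) ℤ).app _) (hS ⟨⟨⟨k, U⟩, hU, h1⟩, ⟨0⟩⟩))

theorem gen_two (hA : IsHereditaryRing A) {𝒞 : Set (DD A)} 
    (h : ∀ X ∈ 𝒞, InLoc (Fam 𝒞) X)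
    (𝒟 : Set (DD A)) (h𝒟 : IsLocalizingSubcategory 𝒟) (h1 : {X | X ∈ 𝒞 ∧ IsPerfectComplex X} ⊆ 𝒟) : 𝒞 ⊆ 𝒟 := by
  intro X hX
  refine h X hX 𝒟 h𝒟 fun i => loc_shift h𝒟 _ (h1 ⟨i.1.2.2, ?_⟩)
  exact perf_quot hA inferInstance inferInstance _ i.1.2.1
end perf2
end Tele

namespace Tele
section one3
variable {A : Type u} [Ring A] [HasDerivedCategory.{w} (ModuleCat.{u} A)]

def ROrth (𝒞 : Set (DD A)) (Y : DD A) : Prop := ∀ X ∈ 𝒞, ∀ f : X ⟶ Y, f = 0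

theorem ROrth.iso {𝒞 : Set (DD A)} {Y Y' : DD A} (h : ROrth 𝒞 Y) (e : Y ≅ Y') : ROrth 𝒞 Y' := by
  intro X hX f
  have := h X hX (f ≫ e.inv)
  rwa [Preadditive.IsIso.comp_right_eq_zero] at this

theorem ROrth.shift {𝒞 : Set (DD A)} (h𝒞 : IsLocalizingSubcategory 𝒞) {Y : DD A} (h : ROrth 𝒞 Y) (n : ℤ) :
    ROrth 𝒞 (Y⟦n⟧) := by
  intro X hX f
  have := h _ (loc_shift h𝒞 (-n) hX) (f⟦-n⟧' ≫ (shiftFunctorCompIsoId (DD A) n (-n) (by simp)).hom.app Y)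
  rw [Preadditive.IsIso.comp_right_eq_zero] at this
  apply (shiftFunctor (DD A) (-n)).map_injective
  rw [this, Functor.map_zero]

theorem rorth_loc {𝒞 : Set (DD A)} (h𝒞 : IsLocalizingSubcategory 𝒞)
    (hco : ∀ (ι : Type u) (g : ι → DD A) (c : Cofan g), IsColimit c → (∀ i, ROrth 𝒞 (g i)) → ROrth 𝒞 c.pt) :
    IsLocalizingSubcategory {Y | ROrth 𝒞 Y} := by
  refine ⟨?_, ?_, ?_, ?_, ?_, hco⟩
  · intro Y hY X _ f
    exact hY.eq_of_tgt _ _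
  · intro Y Y' hY e
    exact ROrth.iso hY e
  · intro Y n hY
    exact ROrth.shift h𝒞 hY n
  · intro T hT h1 h2 X hX f
    obtain ⟨g, hg⟩ := Triangle.coyoneda_exact₃ T hT f (ROrth.shift h𝒞 h1 1 X hX _)
    rw [hg, h2 X hX g, zero_comp]
  · intro Y Y' h X hX f
    have h1 := h X hX (f ≫ biprod.inl)
    have h2 := congrArg (· ≫ (biprod.fst : Y ⊞ Y' ⟶ Y)) h1
    simpa using h2

theorem one_three (hA : IsHereditaryRing A) {𝒞 : Set (DD A)} (h𝒞 : IsLocalizingSubcategory 𝒞)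
    (L : DD A ⥤ DD A) (η : 𝟭 (DD A) ⟶ L) (cs : L.CommShift ℤ) (hL : letI := cs; L.IsTriangulated)
    (h1 : ∀ X, IsIso (L.map (η.app X))) (h2 : ∀ X, L.map (η.app X) = η.app (L.obj X))
    (h3 : ∀ (ι : Type u), PreservesColimitsOfShape (Discrete ι) L) (h4 : {X | IsZero (L.obj X)} = 𝒞) :
    ∃ 𝒟 : Set (DD A), IsLocalizingSubcategory 𝒟 ∧
        (∀ (ι : Type u) (g : ι → DD A) (c : Fan g), IsLimit c → (∀ i, g i ∈ 𝒟) → c.pt ∈ 𝒟) ∧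
        𝒞 = {X | ∀ D ∈ 𝒟, ∀ (n : ℤ) (f : X ⟶ D⟦n⟧), f = 0} := by
  letI := cs
  have hmem : ∀ X, X ∈ 𝒞 ↔ IsZero (L.obj X) := fun X => by rw [← h4]; rfl
  have hL0 : ∀ Y, ROrth 𝒞 (L.obj Y) := by
    intro Y X hX f
    have hn : f ≫ η.app (L.obj Y) = η.app X ≫ L.map f := η.naturality f
    have hiso : IsIso (η.app (L.obj Y)) := by rw [← h2]; exact h1 Y
    have h0 : L.map f = 0 := ((hmem X).1 hX).eq_of_src _ _
    rw [h0, comp_zero] at hn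
    rwa [Preadditive.IsIso.comp_right_eq_zero] at hn
  have hiff : ∀ Y, ROrth 𝒞 Y → IsIso (η.app Y) := by
    intro Y hY
    obtain ⟨Z, g, δ, hT⟩ := distinguished_cocone_triangle (η.app Y)
    have hZ : Z ∈ 𝒞 := by
      rw [hmem]
      have hT' := L.map_distinguished _ hT
      exact (Triangle.isZero₃_iff_isIso₁ _ hT').2 (h1 Y)
    have hδ : δ = 0 := ROrth.shift h𝒞 hY 1 Z hZ δ
    obtain ⟨s, hs⟩ : ∃ s : Z ⟶ L.obj Y, 𝟙 Z = s ≫ g := Triangle.coyoneda_exact₃ _ hT (𝟙 Z) (by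
      exact (Category.id_comp δ).trans hδ)
    have hZ0 : IsZero Z := by
      rw [IsZero.iff_id_eq_zero, hs, hL0 Y Z hZ s, zero_comp]
    exact (Triangle.isZero₃_iff_isIso₁ _ hT).1 hZ0
  have hloc := rorth_loc h𝒞 (by
    intro ι g c hc hg
    have hi := fun i => hiff _ (hg i)
    have hc' := mapCofan L c hc
    have : IsIso (η.app c.pt) := by
      refine ⟨Cofan.IsColimit.desc hc' (fun i => inv (η.app (g i)) ≫ c.inj i), ?_, ?_⟩
      · refine Cofan.IsColimit.hom_ext hc _ _ fun i => ?_
        have hn : c.inj i ≫ η.app c.pt = η.app (g i) ≫ L.map (c.inj i) := η.naturality (c.inj i)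
        have hd := Cofan.IsColimit.fac hc' (fun i => inv (η.app (g i)) ≫ c.inj i) i
        refine (Category.assoc _ _ _).symm.trans ?_
        refine (congrArg (· ≫ _) hn).trans ?_
        refine (Category.assoc _ _ _).trans ?_
        refine (congrArg (η.app (g i) ≫ ·) hd).trans ?_
        refine (IsIso.hom_inv_id_assoc _ _).trans (Category.comp_id _).symm
      · refine Cofan.IsColimit.hom_ext hc' _ _ fun i => ?_
        have hn : c.inj i ≫ η.app c.pt = η.app (g i) ≫ L.map (c.inj i) := η.naturality (c.inj i)
        have hd := Cofan.IsColimit.fac hc' (fun i => inv (η.app (g i)) ≫ c.inj i) i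
        refine (Category.assoc _ _ _).symm.trans ?_
        refine (congrArg (· ≫ _) hd).trans ?_
        refine (Category.assoc _ _ _).trans ?_
        refine (congrArg (inv (η.app (g i)) ≫ ·) hn).trans ?_
        refine (IsIso.inv_hom_id_assoc _ _).trans (Category.comp_id _).symm
    exact (hL0 c.pt).iso (asIso (η.app c.pt)).symm)
  refine ⟨_, hloc, ?_, ?_⟩
  · intro ι g c hc hg X hX f
    refine Fan.IsLimit.hom_ext hc _ _ fun i => ?_
    rw [hg i X hX (f ≫ c.proj i), zero_comp]
  · ext X
    refine Iff.trans ?_ (lorth_iff hloc X)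
    constructor
    · intro hX D hD f
      exact hD X hX f
    · intro h
      have h0 : η.app X = 0 := h _ (hL0 X) _
      rw [hmem]
      have h5 := h1 X
      rw [h0, L.map_zero] at h5
      exact (IsZero.iff_id_eq_zero _).2 ((IsIso.hom_inv_id (0 : L.obj ((𝟭 (DD A)).obj X) ⟶ L.obj (L.obj X))).symm.trans zero_comp)
end one3
end Tele

namespace Tele
section two1
variable {A : Type u} [Ring A] [HasDerivedCategory.{w} (ModuleCat.{u} A)]

theorem lorth_loc {𝒱 : Set (DD A)} (h𝒱 : ∀ Y ∈ 𝒱, ∀ n : ℤ, Y⟦n⟧ ∈ 𝒱) :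
    IsLocalizingSubcategory {X | LOrth 𝒱 X} := by
  have hs : ∀ (X : DD A) (n : ℤ), LOrth 𝒱 X → LOrth 𝒱 (X⟦n⟧) := by
    intro X n h Y hY f
    have := h _ (h𝒱 Y hY (-n)) (shEq _ _ _ f)
    rw [← (shEq X Y n).symm_apply_apply f, this, shEq_symm_zero]
  refine ⟨?_, ?_, hs, ?_, ?_, ?_⟩
  · intro X hX Y _ f
    exact hX.eq_of_src _ _
  · intro X X' hX e
    exact LOrth.iso hX e
  · intro T hT h1 h2 Y hY f
    obtain ⟨g, hg⟩ := Triangle.yoneda_exact₃ T hT f (h2 Y hY _)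
    rw [hg, hs _ 1 h1 Y hY g, comp_zero]
  · intro X X' h Y hY f
    have h1 := h Y hY (biprod.fst ≫ f)
    have h2 := congrArg ((biprod.inl : X ⟶ X ⊞ X') ≫ ·) h1
    simpa using h2
  · intro ι g c hc h Y hY f
    refine Cofan.IsColimit.hom_ext hc _ _ fun i => ?_
    rw [h i Y hY (c.inj i ≫ f), comp_zero]

theorem fam_orth {𝒞 : Set (DD A)} (h : ∀ X ∈ 𝒞, InLoc (Fam 𝒞) X) {V : DD A}
    (hV : ∀ i (k : Fam 𝒞 i ⟶ V), k = 0) : ROrth 𝒞 V := by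
  have hsh : ∀ Y ∈ {V : DD A | ∀ i (k : Fam 𝒞 i ⟶ V), k = 0}, ∀ n : ℤ, Y⟦n⟧ ∈ {V : DD A | ∀ i (k : Fam 𝒞 i ⟶ V), k = 0} := by
    intro Y hY n i k
    obtain ⟨j, ⟨e⟩⟩ := fam_shift 𝒞 i (-n)
    have h1 := hY j (e.hom ≫ k⟦-n⟧' ≫ (shiftFunctorCompIsoId (DD A) n (-n) (by simp)).hom.app Y)
    rw [Preadditive.IsIso.comp_left_eq_zero, Preadditive.IsIso.comp_right_eq_zero] at h1
    apply (shiftFunctor (DD A) (-n)).map_injective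
    rw [h1, Functor.map_zero]
  intro X hX f
  exact h X hX _ (lorth_loc hsh) (fun i Y hY f => hY i f) V hV f

/-- the right orthogonal as an object property -/
def PP (𝒞 : Set (DD A)) : ObjectProperty (DD A) := fun Y => ROrth 𝒞 Y

instance pp_iso (𝒞 : Set (DD A)) : (PP 𝒞).IsClosedUnderIsomorphisms where
  of_iso e h := ROrth.iso h e

theorem pp_tri {𝒞 : Set (DD A)} (hloc : IsLocalizingSubcategory {Y | ROrth 𝒞 Y}) : (PP 𝒞).IsTriangulated := by
  have h1 : (PP 𝒞).ContainsZero := ⟨⟨_, isZero_zero _, hloc.1 _ (isZero_zero _)⟩⟩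
  have h2 : (PP 𝒞).IsStableUnderShift ℤ := ⟨fun n => ⟨fun Y hY => loc_shift hloc n hY⟩⟩
  have h3 : (PP 𝒞).IsTriangulatedClosed₂ := ObjectProperty.IsTriangulatedClosed₂.mk' fun T hT a b => loc_two hloc T hT a b
  exact {}

theorem pp_colim {𝒞 : Set (DD A)} (hloc : IsLocalizingSubcategory {Y | ROrth 𝒞 Y}) (ι : Type u) :
    (PP 𝒞).IsClosedUnderColimitsOfShape (Discrete ι) := by
  refine ⟨?_⟩
  rintro X ⟨p⟩
  have hc : IsColimit (Cofan.mk X (fun i => p.ι.app ⟨i⟩) : Cofan (fun i => p.diag.obj ⟨i⟩)) := by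
    refine Cofan.IsColimit.mk _ (fun s => p.isColimit.desc ⟨s.pt, Discrete.natTrans fun i => s.inj i.as⟩) ?_ ?_
    · intro s i
      exact p.isColimit.fac _ _
    · intro s m hm
      exact p.isColimit.uniq ⟨s.pt, Discrete.natTrans fun i => s.inj i.as⟩ m fun i => hm i.as
  exact loc_coprod hloc hc fun i => p.prop_diag_obj ⟨i⟩

theorem two_one {𝒞 : Set (DD A)} (h𝒞 : IsLocalizingSubcategory 𝒞) (hloc : IsLocalizingSubcategory {Y | ROrth 𝒞 Y})
    (htri : ∀ X : DD A, ∃ (W V : DD A) (f : W ⟶ X) (g : X ⟶ V) (h : V ⟶ W⟦(1 : ℤ)⟧), Triangle.mk f g h ∈ distTriang (DD A) ∧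
      W ∈ 𝒞 ∧ ROrth 𝒞 V) :
    ∃ (L : DD A ⥤ DD A) (η : 𝟭 (DD A) ⟶ L) (cs : L.CommShift ℤ),
        (letI := cs; L.IsTriangulated) ∧
        (∀ X, IsIso (L.map (η.app X))) ∧
        (∀ X, L.map (η.app X) = η.app (L.obj X)) ∧
        (∀ (ι : Type u), PreservesColimitsOfShape (Discrete ι) L) ∧
        {X | IsZero (L.obj X)} = 𝒞 := by
  have := pp_tri hloc
  have hcl := pp_colim hloc
  choose W V f g δ hT hW hV using htri
  have hb : ∀ (X : DD A) (Y : (PP 𝒞).FullSubcategory), Function.Bijective (fun k : V X ⟶ Y.obj => g X ≫ k) := by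
    intro X Y
    constructor
    · intro k k' h
      have h0 : g X ≫ (k - k') = 0 := by rw [Preadditive.comp_sub]; exact sub_eq_zero.2 h
      obtain ⟨l, hl⟩ : ∃ l : (W X)⟦(1 : ℤ)⟧ ⟶ Y.obj, k - k' = δ X ≫ l := Triangle.yoneda_exact₃ _ (hT X) _ h0
      rw [Y.property _ (loc_shift h𝒞 1 (hW X)) l, comp_zero] at hl
      exact sub_eq_zero.1 hl
    · intro k
      obtain ⟨l, hl⟩ : ∃ l : V X ⟶ Y.obj, k = g X ≫ l := Triangle.yoneda_exact₂ _ (hT X) k (Y.property _ (hW X) _)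
      exact ⟨l, hl.symm⟩
  let e : ∀ (X : DD A) (Y : (PP 𝒞).FullSubcategory), ((⟨V X, hV X⟩ : (PP 𝒞).FullSubcategory) ⟶ Y) ≃ (X ⟶ (PP 𝒞).ι.obj Y) :=
    fun X Y => (PP 𝒞).fullyFaithfulι.homEquiv.trans (Equiv.ofBijective _ (hb X Y))
  have he : ∀ X Y Y' (k : Y ⟶ Y') (h : (⟨V X, hV X⟩ : (PP 𝒞).FullSubcategory) ⟶ Y), e X Y' (h ≫ k) = e X Y h ≫ (PP 𝒞).ι.map k := by
    intro X Y Y' k h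
    exact (Category.assoc _ _ _).symm
  let F := Adjunction.leftAdjointOfEquiv e he
  let adj : F ⊣ (PP 𝒞).ι := Adjunction.adjunctionOfEquivLeft e he
  letI : F.CommShift ℤ := adj.leftAdjointCommShift ℤ
  have hcs : adj.CommShift ℤ := adj.commShift_of_rightAdjoint ℤ
  have hF : F.IsTriangulated := adj.isTriangulated_leftAdjoint
  have hpl : ∀ (ι : Type u), PreservesColimitsOfShape (Discrete ι) F := fun ι =>
    (adj.leftAdjoint_preservesColimits).preservesColimitsOfShape
  have hpi : ∀ (ι : Type u), PreservesColimitsOfShape (Discrete ι) (PP 𝒞).ι := fun ι => inferInstance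
  have hz : ∀ X, IsZero ((F ⋙ (PP 𝒞).ι).obj X) ↔ X ∈ 𝒞 := by
    intro X
    change IsZero (V X) ↔ _
    constructor
    · intro h
      obtain ⟨s, hs⟩ : ∃ s : X ⟶ W X, 𝟙 X = s ≫ f X := Triangle.coyoneda_exact₂ _ (hT X) (𝟙 X) (h.eq_of_tgt _ _)
      exact loc_retract h𝒞 s (f X) hs.symm (hW X)
    · intro h
      have hVC := loc_three h𝒞 _ (hT X) (hW X) h
      exact (IsZero.iff_id_eq_zero _).2 (hV X _ hVC _)
  refine ⟨F ⋙ (PP 𝒞).ι, adj.unit, inferInstance, inferInstance, ?_, ?_, ?_, ?_⟩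
  · intro X
    have h1 : F.map (adj.unit.app X) ≫ adj.counit.app (F.obj X) = 𝟙 _ := adj.left_triangle_components X
    have h2 : IsIso (F.map (adj.unit.app X)) := by
      have h3 : F.map (adj.unit.app X) = inv (adj.counit.app (F.obj X)) := (IsIso.eq_inv_of_inv_hom_id h1)
      rw [h3]
      infer_instance
    exact Functor.map_isIso (PP 𝒞).ι (F.map (adj.unit.app X))
  · intro X
    have h1 : F.map (adj.unit.app X) ≫ adj.counit.app (F.obj X) = 𝟙 _ := adj.left_triangle_components X
    have h1' : (PP 𝒞).ι.map (F.map (adj.unit.app X)) ≫ (PP 𝒞).ι.map (adj.counit.app (F.obj X)) = 𝟙 _ := by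
      rw [← Functor.map_comp, h1, CategoryTheory.Functor.map_id]
    have h2 : adj.unit.app ((PP 𝒞).ι.obj (F.obj X)) ≫ (PP 𝒞).ι.map (adj.counit.app (F.obj X)) = 𝟙 _ :=
      adj.right_triangle_components (F.obj X)
    exact (cancel_mono ((PP 𝒞).ι.map (adj.counit.app (F.obj X)))).1 (h1'.trans h2.symm)
  · intro ι
    infer_instance
  · ext X
    exact hz X
end two1
end Tele

namespace Tele
section fin
variable {A : Type u} [Ring A] [HasDerivedCategory.{w} (ModuleCat.{u} A)]

theorem gen_one (hA : IsHereditaryRing A) {𝒞 : Set (DD A)} (h𝒞 : IsLocalizingSubcategory 𝒞)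
    (h : ∀ X ∈ 𝒞, InLoc (Fam 𝒞) X) :
    ∃ (L : DD A ⥤ DD A) (η : 𝟭 (DD A) ⟶ L) (cs : L.CommShift ℤ),
        (letI := cs; L.IsTriangulated) ∧
        (∀ X, IsIso (L.map (η.app X))) ∧
        (∀ X, L.map (η.app X) = η.app (L.obj X)) ∧
        (∀ (ι : Type u), PreservesColimitsOfShape (Discrete ι) L) ∧
        {X | IsZero (L.obj X)} = 𝒞 := by
  refine two_one h𝒞 (rorth_loc h𝒞 ?_) ?_
  · intro ι g c hc hg
    refine fam_orth h fun i k => ?_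
    obtain ⟨t, l, rfl⟩ := fam_cpt hA 𝒞 i ι g c hc k
    refine Finset.sum_eq_zero fun j _ => ?_
    rw [hg j _ (fam_mem h𝒞 i) (l j), zero_comp]
  · intro X
    obtain ⟨W, V, f, g, δ, hT, hW, hV⟩ := bousfield (Fam 𝒞) (fam_small hA 𝒞) (fam_shift 𝒞) (fam_cpt hA 𝒞) X
    exact ⟨W, V, f, g, δ, hT, hW 𝒞 h𝒞 (fam_mem h𝒞), fam_orth h hV⟩

theorem three_two (hA : IsHereditaryRing A) {𝒞 : Set (DD A)} (h𝒞 : IsLocalizingSubcategory 𝒞)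
    (h : ∃ 𝒟 : Set (DD A), IsLocalizingSubcategory 𝒟 ∧
        (∀ (ι : Type u) (g : ι → DD A) (c : Fan g), IsLimit c → (∀ i, g i ∈ 𝒟) → c.pt ∈ 𝒟) ∧
        𝒞 = {X | ∀ D ∈ 𝒟, ∀ (n : ℤ) (f : X ⟶ D⟦n⟧), f = 0})
    (𝒟 : Set (DD A)) (h𝒟 : IsLocalizingSubcategory 𝒟) (h1 : {X | X ∈ 𝒞 ∧ IsPerfectComplex X} ⊆ 𝒟) : 𝒞 ⊆ 𝒟 := by
  obtain ⟨ℰ, hℰ, hpi, heq⟩ := h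
  refine gen_two hA (fun X hX => three_gen hA h𝒞 hℰ hpi (fun X => ?_) X hX) 𝒟 h𝒟 h1
  rw [lorth_iff hℰ, heq]
  rfl
end fin
end Tele

variable {A : Type u} [Ring A] [HasDerivedCategory.{w} (ModuleCat.{u} A)]
open Tele

/-- the telescope conjecture for the derived category of a hereditary ring:
for a localizing subcategory `𝒞` of `D(Mod A)`, the following are equivalent:
(1) `𝒞` is the kernel of a coproduct-preserving localization functor;
(2) `𝒞` is generated by the perfect complexes it contains;
(3) `𝒞 = ^⊥𝒟` for some localizing subcategory `𝒟` closed under arbitrary products. -/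
theorem telescope_conjecture_hereditary
    (hA : IsHereditaryRing A)
    (𝒞 : Set (DerivedCategory (ModuleCat.{u} A)))
    (h𝒞 : IsLocalizingSubcategory 𝒞) :
    ((∃ (L : DerivedCategory (ModuleCat.{u} A) ⥤ DerivedCategory (ModuleCat.{u} A))
        (η : 𝟭 (DerivedCategory (ModuleCat.{u} A)) ⟶ L) (cs : L.CommShift ℤ),
        (letI := cs; L.IsTriangulated) ∧
        (∀ X, IsIso (L.map (η.app X))) ∧
        (∀ X, L.map (η.app X) = η.app (L.obj X)) ∧
        (∀ (ι : Type u), PreservesColimitsOfShape (Discrete ι) L) ∧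
        {X | IsZero (L.obj X)} = 𝒞) ↔
      (∀ 𝒟 : Set (DerivedCategory (ModuleCat.{u} A)), IsLocalizingSubcategory 𝒟 →
        {X | X ∈ 𝒞 ∧ IsPerfectComplex X} ⊆ 𝒟 → 𝒞 ⊆ 𝒟)) ∧
    ((∀ 𝒟 : Set (DerivedCategory (ModuleCat.{u} A)), IsLocalizingSubcategory 𝒟 →
        {X | X ∈ 𝒞 ∧ IsPerfectComplex X} ⊆ 𝒟 → 𝒞 ⊆ 𝒟) ↔
      (∃ 𝒟 : Set (DerivedCategory (ModuleCat.{u} A)), IsLocalizingSubcategory 𝒟 ∧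
        (∀ (ι : Type u) (g : ι → DerivedCategory (ModuleCat.{u} A)) (c : Fan g),
          IsLimit c → (∀ i, g i ∈ 𝒟) → c.pt ∈ 𝒟) ∧
        𝒞 = {X | ∀ D ∈ 𝒟, ∀ (n : ℤ) (f : X ⟶ D⟦n⟧), f = 0})) := by
  refine ⟨⟨?_, fun h => gen_one hA h𝒞 (two_gen hA h𝒞 h)⟩, ⟨fun h => ?_, three_two hA h𝒞⟩⟩
  · rintro ⟨L, η, cs, hL, h1, h2, h3, h4⟩
    exact three_two hA h𝒞 (one_three hA h𝒞 L η cs hL h1 h2 h3 h4)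
  · obtain ⟨L, η, cs, hL, h1, h2, h3, h4⟩ := gen_one hA h𝒞 (two_gen hA h𝒞 h)
    exact one_three hA h𝒞 L η cs hL h1 h2 h3 h4
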